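/- arXiv:1305.4262 — 2 statements merged into one kernel-verified Lean document; each statement's English description precedes it below -/
import Mathlib

section
/- Let n ≥ 2, let A(D) be a homogeneous linear differential operator of order k on ℝⁿ from V to E, let ℓ ∈ {1, …, min(k, n−1)} and q ∈ [1, n/(n−ℓ)). If A(D) is elliptic and canceling, then there exists a constant C > 0 such that for every u ∈ C_c^∞(ℝⁿ; V), (∫_{ℝⁿ} |D^{k−ℓ}u(x)|^q / |x|^{n−(n−ℓ)q} dx)^{1/q} ≤ C ∫_{ℝⁿ} |A(D)u(x)| dx. -/
open MeasureTheory ENNReal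
open scoped NNReal RealInnerProductSpace

noncomputable section

/-- A homogeneous linear differential operator `A(D)` of order `k` from `V` to `E` on a
Euclidean space `X`, represented through its action `u ↦ A (D^k u)` on the `k`-th
iterated (Fréchet) derivative; this is equivalent to the data of a family of coefficients
`(A_α)_{|α| = k}`, `A_α ∈ 𝓛(V; E)`, acting by `A(D)u = ∑_{|α|=k} A_α (∂^α u)`. -/
abbrev DiffOperator (X : Type*) [NormedAddCommGroup X] [InnerProductSpace ℝ X]
    (k : ℕ) (V E : Type*) [NormedAddCommGroup V] [NormedSpace ℝ V]
    [NormedAddCommGroup E] [NormedSpace ℝ E] :=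
  ContinuousMultilinearMap ℝ (fun _ : Fin k => X) V →L[ℝ] E

namespace DiffOperator

variable {X : Type*} [NormedAddCommGroup X] [InnerProductSpace ℝ X]
  {k : ℕ} {V E : Type*} [NormedAddCommGroup V] [NormedSpace ℝ V]
  [NormedAddCommGroup E] [NormedSpace ℝ E]

/-- The action `A(D)u` of the differential operator on a function `u : X → V`. -/
noncomputable def app (A : DiffOperator X k V E) (u : X → V) (x : X) : E :=
  A (iteratedFDeriv ℝ k u x)

/-- The symbol `A(ξ) = ∑_{|α|=k} ξ^α A_α ∈ 𝓛(V; E)` of the operator: it sends `v : V` to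
`A` applied to the `k`-linear map `(w₁, …, w_k) ↦ (⟪ξ,w₁⟫ ⋯ ⟪ξ,w_k⟫) • v`. -/
noncomputable def symbol (A : DiffOperator X k V E) (ξ : X) : V →L[ℝ] E :=
  A.comp (((ContinuousMultilinearMap.compContinuousLinearMapL
      (fun _ : Fin k => innerSL ℝ ξ)).comp
    (ContinuousMultilinearMap.piFieldEquiv ℝ (Fin k)
      V).toContinuousLinearEquiv.toContinuousLinearMap))

/-- `A(D)` is elliptic if its symbol `A(ξ)` is injective for every `ξ ≠ 0`. -/
def IsElliptic (A : DiffOperator X k V E) : Prop :=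
  ∀ ξ : X, ξ ≠ 0 → Function.Injective (A.symbol ξ)

/-- `A(D)` is canceling if `⋂_{ξ ≠ 0} A(ξ)[V] = {0}`. -/
def IsCanceling (A : DiffOperator X k V E) : Prop :=
  (⋂ (ξ : X) (_ : ξ ≠ 0), Set.range (A.symbol ξ)) = {0}

end DiffOperator

/-- `u ∈ C_c^∞`: a smooth compactly supported function. -/
def IsTestFun {X V : Type*} [NormedAddCommGroup X] [NormedSpace ℝ X]
    [NormedAddCommGroup V] [NormedSpace ℝ V] (u : X → V) : Prop :=
  ContDiff ℝ (⊤ : ℕ∞) u ∧ HasCompactSupport u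

section Part1

set_option linter.unusedSectionVars false

variable {X : Type*} [NormedAddCommGroup X] [InnerProductSpace ℝ X] [FiniteDimensional ℝ X]
  [MeasurableSpace X] [BorelSpace X]

/-- The comparison kernel. -/
def kr (d : ℝ) (x y : X) : ℝ :=
  if 2 * ‖y‖ ≤ ‖x‖ then ‖y‖ * ‖x‖ ^ (-(d + 1)) else ‖x - y‖ ^ (-d)

lemma kr_nonneg (d : ℝ) (x y : X) : 0 ≤ kr d x y := by
  unfold kr; split_ifs <;> positivity

lemma kr_measurable (d : ℝ) : Measurable (fun p : X × X => kr d p.1 p.2) := by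
  unfold kr
  refine Measurable.ite ?_ (by fun_prop) (by fun_prop)
  exact measurableSet_le (by fun_prop) (by fun_prop)

lemma kr_smul (d : ℝ) {R : ℝ} (hR : 0 < R) (x y : X) :
    kr d (R • x) (R • y) = R ^ (-d) * kr d x y := by
  unfold kr
  have h1 : ‖R • x‖ = R * ‖x‖ := by rw [norm_smul, Real.norm_of_nonneg hR.le]
  have h2 : ‖R • y‖ = R * ‖y‖ := by rw [norm_smul, Real.norm_of_nonneg hR.le]
  have h3 : ‖R • x - R • y‖ = R * ‖x - y‖ := by
    rw [← smul_sub, norm_smul, Real.norm_of_nonneg hR.le]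
  rw [h1, h2, h3]
  have : (2 * (R * ‖y‖) ≤ R * ‖x‖) ↔ 2 * ‖y‖ ≤ ‖x‖ := by
    rw [show 2 * (R * ‖y‖) = R * (2 * ‖y‖) by ring]
    exact mul_le_mul_iff_right₀ hR
  simp only [this]
  split_ifs
  · rw [Real.mul_rpow hR.le (norm_nonneg _), neg_add, Real.rpow_add hR, Real.rpow_neg_one]
    field_simp
  · rw [Real.mul_rpow hR.le (norm_nonneg _)]

lemma lintegral_scale (F : X → ℝ≥0∞) {R : ℝ} (hR : 0 < R) :
    ∫⁻ x, F x = ENNReal.ofReal (R ^ Module.finrank ℝ X) * ∫⁻ x, F (R • x) := by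
  have h := Measure.map_addHaar_smul (volume : Measure X) hR.ne'
  have h2 : ∫⁻ x, F x ∂(Measure.map (R • ·) (volume : Measure X)) = ∫⁻ x, F (R • x) := by
    have : MeasurableEmbedding (fun x : X => R • x) :=
      (Homeomorph.smulOfNeZero R hR.ne').measurableEmbedding
    rw [this.lintegral_map]
  rw [← h2, h, lintegral_smul_measure, smul_eq_mul, ← mul_assoc, ← ENNReal.ofReal_mul (by positivity),
    abs_of_pos (by positivity), mul_inv_cancel₀ (by positivity)]
  simp

lemma ball_fin [Nontrivial X] {s r : ℝ} (hs : s < Module.finrank ℝ X) :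
    ∫⁻ x in Metric.ball (0 : X) r, ENNReal.ofReal (‖x‖ ^ (-s)) < ⊤ := by
  have h : IntegrableOn (fun x : X => ‖x‖ ^ (-s)) (Metric.ball 0 r) := by
    refine integrableOn_ball_of_norm_le_rpow (C := 1) (α := s) (Nat.succ_le_of_lt Module.finrank_pos) hs ?_ ?_
    · refine Filter.Eventually.of_forall fun x => ?_
      rw [Real.norm_of_nonneg (by positivity), one_mul]
    · exact Measurable.aestronglyMeasurable (by fun_prop)
  have := h.hasFiniteIntegral
  rw [hasFiniteIntegral_iff_norm] at this
  convert this using 3 with x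
  rw [Real.norm_of_nonneg (by positivity)]

lemma kr_unit_bound [Nontrivial X] {d q : ℝ} (hd : 0 < d) (hq : 1 ≤ q)
    (hdq : d * q < Module.finrank ℝ X) :
    ∃ C : ℝ≥0∞, C ≠ ⊤ ∧ ∀ y : X, ‖y‖ = 1 →
      ∫⁻ x, ENNReal.ofReal (kr d x y ^ q * ‖x‖ ^ (d * q - Module.finrank ℝ X)) ≤ C := by
  set N : ℝ := (Module.finrank ℝ X : ℝ) with hN
  set a := d * q with ha
  have ha0 : 0 < a := by positivity
  set F1 : X → ℝ≥0∞ := fun x => ENNReal.ofReal (2 ^ (N + q)) * ENNReal.ofReal ((1 + ‖x‖) ^ (-(N + q)))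
  set F2 : X → ℝ≥0∞ := (Metric.ball (0 : X) 2).indicator
    (fun x => ENNReal.ofReal (2 ^ a) * ENNReal.ofReal (‖x‖ ^ (-(N - a))))
  set F3 : X → ℝ≥0∞ := (Metric.ball (0 : X) 3).indicator
    (fun x => ENNReal.ofReal (2 ^ (N - a)) * ENNReal.ofReal (‖x‖ ^ (-a)))
  have m1 : Measurable F1 := by fun_prop
  have m2 : Measurable F2 := Measurable.indicator (by fun_prop) measurableSet_ball
  have m3 : Measurable F3 := Measurable.indicator (by fun_prop) measurableSet_ball
  have i1 : ∫⁻ x, F1 x < ⊤ := by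
    rw [lintegral_const_mul _ (by fun_prop)]
    exact ENNReal.mul_lt_top ENNReal.ofReal_lt_top (finite_integral_one_add_norm (by linarith))
  have i2 : ∫⁻ x, F2 x < ⊤ := by
    rw [lintegral_indicator measurableSet_ball, lintegral_const_mul _ (by fun_prop)]
    exact ENNReal.mul_lt_top ENNReal.ofReal_lt_top (ball_fin (by linarith))
  have i3 : ∫⁻ x, F3 x < ⊤ := by
    rw [lintegral_indicator measurableSet_ball, lintegral_const_mul _ (by fun_prop)]
    exact ENNReal.mul_lt_top ENNReal.ofReal_lt_top (ball_fin (by linarith))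
  refine ⟨(∫⁻ x, F1 x) + ((∫⁻ x, F2 x) + (∫⁻ x, F3 x)),
    ENNReal.add_ne_top.2 ⟨i1.ne, ENNReal.add_ne_top.2 ⟨i2.ne, i3.ne⟩⟩, fun y hy => ?_⟩
  have e3 : ∫⁻ x, F3 x = ∫⁻ x, F3 (x - y) := (lintegral_sub_right_eq_self F3 y).symm
  rw [e3, ← lintegral_add_left m2, ← lintegral_add_left m1]
  refine lintegral_mono fun x => ?_
  simp only
  by_cases hx : 2 ≤ ‖x‖
  · refine le_trans ?_ (le_add_right (le_refl _))
    simp only [F1]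
    rw [← ENNReal.ofReal_mul (by positivity)]
    refine ENNReal.ofReal_le_ofReal ?_
    have : kr d x y = ‖x‖ ^ (-(d + 1)) := by
      unfold kr; rw [hy]; simp [hx]
    have hx0 : 0 < ‖x‖ := by linarith
    rw [this, ← Real.rpow_mul hx0.le, ← Real.rpow_add hx0]
    have : -(d + 1) * q + (a - N) = -(N + q) := by rw [ha]; ring
    rw [this, Real.rpow_neg (by positivity), Real.rpow_neg (by positivity), ← div_eq_mul_inv,
      inv_eq_one_div, div_le_div_iff₀ (by positivity) (by positivity), one_mul,
      ← Real.mul_rpow (by positivity) (by positivity)]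
    exact Real.rpow_le_rpow (by positivity) (by linarith) (by positivity)
  · push Not at hx
    refine le_trans ?_ (le_add_left (le_refl _))
    have hk : kr d x y = ‖x - y‖ ^ (-d) := by
      unfold kr; rw [hy]; simp [hx]
    have hxy : ‖x - y‖ < 3 := by
      have := norm_sub_le x y; linarith
    have hk2 : kr d x y ^ q = ‖x - y‖ ^ (-a) := by
      rw [hk, ← Real.rpow_mul (norm_nonneg _)]; congr 1; rw [ha]; ring
    have hy1 : (1 : ℝ) ≤ ‖x‖ + ‖x - y‖ := by
      have := norm_sub_le x (x - y)
      rw [_root_.sub_sub_cancel, hy] at this; exact this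
    rw [hk2, show a - N = -(N - a) by ring]
    by_cases hc : ‖x‖ ≤ ‖x - y‖
    · refine le_trans ?_ (le_add_right (le_refl _))
      simp only [F2]
      rw [Set.indicator_of_mem (by simpa using hx), ← ENNReal.ofReal_mul (by positivity)]
      refine ENNReal.ofReal_le_ofReal ?_
      refine mul_le_mul_of_nonneg_right ?_ (by positivity)
      have hh : (1 / 2 : ℝ) ≤ ‖x - y‖ := by linarith
      calc ‖x - y‖ ^ (-a) ≤ (1 / 2 : ℝ) ^ (-a) :=
            Real.rpow_le_rpow_of_nonpos (by norm_num) hh (by linarith)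
        _ = 2 ^ a := by rw [Real.rpow_neg (by norm_num), one_div, Real.inv_rpow (by norm_num), inv_inv]
    · push Not at hc
      refine le_trans ?_ (le_add_left (le_refl _))
      simp only [F3]
      rw [Set.indicator_of_mem (by simpa using hxy), ← ENNReal.ofReal_mul (by positivity)]
      refine ENNReal.ofReal_le_ofReal ?_
      rw [mul_comm]
      refine mul_le_mul_of_nonneg_right ?_ (by positivity)
      have hh : (1 / 2 : ℝ) ≤ ‖x‖ := by linarith
      calc ‖x‖ ^ (-(N - a)) ≤ (1 / 2 : ℝ) ^ (-(N - a)) :=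
            Real.rpow_le_rpow_of_nonpos (by norm_num) hh (by linarith)
        _ = 2 ^ (N - a) := by
            rw [Real.rpow_neg (by norm_num), one_div, Real.inv_rpow (by norm_num), inv_inv]

lemma kr_bound [Nontrivial X] {d q : ℝ} (hd : 0 < d) (hq : 1 ≤ q)
    (hdq : d * q < Module.finrank ℝ X) :
    ∃ C : ℝ≥0∞, C ≠ ⊤ ∧ ∀ y : X, y ≠ 0 →
      ∫⁻ x, ENNReal.ofReal (kr d x y ^ q * ‖x‖ ^ (d * q - Module.finrank ℝ X)) ≤ C := by
  obtain ⟨C, hC, h⟩ := kr_unit_bound (X := X) hd hq hdq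
  refine ⟨C, hC, fun y hy => ?_⟩
  have hR : 0 < ‖y‖ := norm_pos_iff.mpr hy
  have hu : ‖‖y‖⁻¹ • y‖ = 1 := by
    rw [norm_smul, norm_inv, norm_norm, inv_mul_cancel₀ hR.ne']
  have hy' : ‖y‖ • (‖y‖⁻¹ • y) = y := by rw [smul_smul, mul_inv_cancel₀ hR.ne', one_smul]
  refine le_trans (le_of_eq ?_) (h _ hu)
  rw [lintegral_scale _ hR, ← lintegral_const_mul']
  swap; · exact ENNReal.ofReal_ne_top
  refine lintegral_congr fun x => ?_
  rw [← ENNReal.ofReal_mul (by positivity)]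
  congr 1
  have hks : kr d (‖y‖ • x) y = ‖y‖ ^ (-d) * kr d x (‖y‖⁻¹ • y) := by
    rw [← kr_smul d hR, hy']
  rw [hks]
  rw [Real.mul_rpow (by positivity) (kr_nonneg _ _ _), norm_smul, norm_norm,
    Real.mul_rpow (by positivity) (by positivity), ← Real.rpow_mul hR.le, ← Real.rpow_natCast]
  have : ‖y‖ ^ ((Module.finrank ℝ X : ℕ) : ℝ) * ‖y‖ ^ (-d * q) * ‖y‖ ^ (d * q - Module.finrank ℝ X) = 1 := by
    rw [← Real.rpow_add hR, ← Real.rpow_add hR]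
    convert Real.rpow_zero _ using 2
    ring
  linear_combination (kr d x (‖y‖⁻¹ • y) ^ q * ‖x‖ ^ (d * q - Module.finrank ℝ X)) * this

/-- Schur-type bound: the linear operator with kernel `kr` maps `L¹` to weighted `L^q`. -/
lemma schur_bound [Nontrivial X] {d q : ℝ} (hd : 0 < d) (hq : 1 ≤ q)
    (hdq : d * q < Module.finrank ℝ X) :
    ∃ C : ℝ≥0∞, C ≠ ⊤ ∧ ∀ F : X → ℝ≥0∞, Measurable F →
      (∫⁻ x, (∫⁻ y, ENNReal.ofReal (kr d x y) * F y) ^ q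
        * ENNReal.ofReal (‖x‖ ^ (d * q - Module.finrank ℝ X))) ^ (1 / q)
        ≤ C * ∫⁻ y, F y := by
  obtain ⟨C, hC, h⟩ := kr_bound (X := X) hd hq hdq
  have hq0 : 0 < q := by linarith
  refine ⟨C ^ (1 / q), ENNReal.rpow_ne_top_of_nonneg (by positivity) hC, fun F hF => ?_⟩
  have hkm : Measurable (fun p : X × X => ENNReal.ofReal (kr d p.1 p.2)) := (kr_measurable d).ennreal_ofReal
  set I := ∫⁻ y, F y
  have hol : ∀ x : X, (∫⁻ y, ENNReal.ofReal (kr d x y) * F y) ^ q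
      ≤ I ^ (q - 1) * ∫⁻ y, ENNReal.ofReal (kr d x y) ^ q * F y := by
    intro x
    have hkx : Measurable (fun y : X => ENNReal.ofReal (kr d x y)) := hkm.comp measurable_prodMk_left
    rcases eq_or_lt_of_le hq with rfl | hq1
    · simp
    · have hc := Real.HolderConjugate.conjExponent hq1
      have := ENNReal.lintegral_mul_le_Lp_mul_Lq volume hc
        (f := fun y => ENNReal.ofReal (kr d x y) * F y ^ (1 / q))
        (g := fun y => F y ^ (1 / q.conjExponent)) (by fun_prop) (by fun_prop)
      have e1 : ∀ y, ((fun y => ENNReal.ofReal (kr d x y) * F y ^ (1 / q)) * fun y =>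
          F y ^ (1 / q.conjExponent)) y = ENNReal.ofReal (kr d x y) * F y := by
        intro y
        simp only [Pi.mul_apply]
        rw [mul_assoc, ← ENNReal.rpow_add_of_nonneg _ _ (by positivity)
          (by have := hc.symm.pos; positivity)]
        rw [one_div, one_div, hc.inv_add_inv_eq_one, ENNReal.rpow_one]
      simp_rw [e1] at this
      have e2 : ∀ y, (ENNReal.ofReal (kr d x y) * F y ^ (1 / q)) ^ q
          = ENNReal.ofReal (kr d x y) ^ q * F y := by
        intro y
        rw [ENNReal.mul_rpow_of_nonneg _ _ hq0.le, ← ENNReal.rpow_mul, one_div,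
          inv_mul_cancel₀ hq0.ne', ENNReal.rpow_one]
      have e3 : ∀ y, (F y ^ (1 / q.conjExponent)) ^ q.conjExponent = F y := by
        intro y
        rw [← ENNReal.rpow_mul, one_div, inv_mul_cancel₀ hc.symm.pos.ne', ENNReal.rpow_one]
      simp_rw [e2, e3] at this
      calc _ ≤ _ := ENNReal.rpow_le_rpow this hq0.le
        _ = _ := by
          rw [ENNReal.mul_rpow_of_nonneg _ _ hq0.le, ← ENNReal.rpow_mul, ← ENNReal.rpow_mul, one_div,
            inv_mul_cancel₀ hq0.ne', ENNReal.rpow_one, mul_comm]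
          congr 2
          unfold Real.conjExponent
          have : q - 1 ≠ 0 := by linarith
          field_simp
  have key : ∫⁻ x, (∫⁻ y, ENNReal.ofReal (kr d x y) * F y) ^ q
        * ENNReal.ofReal (‖x‖ ^ (d * q - Module.finrank ℝ X)) ≤ C * I ^ q := by
    calc _ ≤ ∫⁻ x, ∫⁻ y, I ^ (q - 1) * (ENNReal.ofReal (kr d x y) ^ q * F y *
              ENNReal.ofReal (‖x‖ ^ (d * q - Module.finrank ℝ X))) := by
          refine lintegral_mono fun x => ?_
          have hkx : Measurable (fun y : X => ENNReal.ofReal (kr d x y)) := hkm.comp measurable_prodMk_left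
          dsimp only
          rw [lintegral_const_mul _ (by fun_prop), lintegral_mul_const _ (by fun_prop), ← mul_assoc]
          gcongr
          exact hol x
      _ = ∫⁻ y, ∫⁻ x, I ^ (q - 1) * (ENNReal.ofReal (kr d x y) ^ q * F y *
              ENNReal.ofReal (‖x‖ ^ (d * q - Module.finrank ℝ X))) := by
          rw [lintegral_lintegral_swap]
          refine Measurable.aemeasurable ?_
          have : Measurable (fun p : X × X => F p.2) := hF.comp measurable_snd
          unfold Function.uncurry
          fun_prop
      _ ≤ ∫⁻ y, (I ^ (q - 1) * C) * F y := by
          have : ∀ᵐ y : X, y ≠ 0 := by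
            simp [ae_iff]
          refine lintegral_mono_ae ?_
          filter_upwards [this] with y hy
          have hkx : Measurable (fun x : X => ENNReal.ofReal (kr d x y)) := hkm.comp measurable_prodMk_right
          rw [lintegral_const_mul _ (by fun_prop), mul_assoc]
          gcongr
          have : ∀ x : X, ENNReal.ofReal (kr d x y) ^ q * F y *
              ENNReal.ofReal (‖x‖ ^ (d * q - Module.finrank ℝ X)) =
              ENNReal.ofReal (kr d x y ^ q * ‖x‖ ^ (d * q - Module.finrank ℝ X)) * F y := by
            intro x
            have := kr_nonneg d x y
            rw [ENNReal.ofReal_mul (by positivity), ENNReal.ofReal_rpow_of_nonneg this hq0.le]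
            ring
          simp_rw [this]
          have hm : Measurable (fun x : X => kr d x y) := (kr_measurable d).comp measurable_prodMk_right
          rw [lintegral_mul_const _ (by fun_prop)]
          gcongr
          exact h y hy
      _ = C * (I ^ (q - 1) * I ^ (1 : ℝ)) := by
          rw [lintegral_const_mul _ hF, ENNReal.rpow_one]; ring
      _ = C * I ^ q := by
          rw [← ENNReal.rpow_add_of_nonneg _ _ (by linarith) (by norm_num)]
          congr 2; ring
  calc _ ≤ (C * I ^ q) ^ (1 / q) := ENNReal.rpow_le_rpow key (by positivity)
    _ = _ := by
      rw [ENNReal.mul_rpow_of_nonneg _ _ (by positivity), ← ENNReal.rpow_mul, one_div,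
        mul_inv_cancel₀ hq0.ne', ENNReal.rpow_one]

end Part1

section Part2

set_option linter.unusedSectionVars false

variable {X : Type*} [NormedAddCommGroup X] [InnerProductSpace ℝ X] [FiniteDimensional ℝ X]
  [MeasurableSpace X] [BorelSpace X]

/-- Weight integral used for dyadic pieces. -/
lemma weight_int {a : ℝ} (ha : 0 < a) {M : ℕ} (hM : a + 1 ≤ M) :
    ∃ C : ℝ, 0 ≤ C ∧ ∀ r : ℝ, 0 < r →
      ∫⁻ t in Set.Ioi (0 : ℝ), ENNReal.ofReal (t ^ (-a - 1) * ((1 + r / t) ^ M)⁻¹)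
        ≤ ENNReal.ofReal (C * r ^ (-a)) := by
  set J := ∫⁻ t in Set.Ioi (0 : ℝ), ENNReal.ofReal (t ^ (-a - 1) * ((1 + 1 / t) ^ M)⁻¹) with hJ
  have hJfin : J < ⊤ := by
    have hs : Set.Ioi (0 : ℝ) = Set.Ioc 0 1 ∪ Set.Ioi 1 := (Set.Ioc_union_Ioi_eq_Ioi zero_le_one).symm
    rw [hJ, hs]
    refine lt_of_le_of_lt (lintegral_union_le _ _ _) (ENNReal.add_lt_top.2 ⟨?_, ?_⟩)
    · refine lt_of_le_of_lt (setLIntegral_mono (g := fun _ => 1) measurable_const ?_) (by simp)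
      intro t ht
      have ht0 : 0 < t := ht.1
      rw [← ENNReal.ofReal_one]
      refine ENNReal.ofReal_le_ofReal ?_
      rw [← div_eq_mul_inv, div_le_one (by positivity)]
      calc t ^ (-a - 1) ≤ t ^ (-(M : ℝ)) :=
            Real.rpow_le_rpow_of_exponent_ge ht0 ht.2 (by linarith)
        _ = (1 / t) ^ M := by
            rw [Real.rpow_neg ht0.le, Real.rpow_natCast, one_div, inv_pow]
        _ ≤ _ := pow_le_pow_left₀ (by positivity) (by linarith) _
    · have hi := (integrableOn_Ioi_rpow_of_lt (a := -a - 1) (c := 1) (by linarith) one_pos)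
      have h2 := hi.hasFiniteIntegral
      rw [hasFiniteIntegral_iff_norm] at h2
      refine lt_of_le_of_lt (setLIntegral_mono ?_ ?_) h2
      · fun_prop
      intro t ht
      have ht0 : (0 : ℝ) < t := lt_trans one_pos ht
      rw [Real.norm_of_nonneg (by positivity)]
      refine ENNReal.ofReal_le_ofReal ?_
      refine mul_le_of_le_one_right (by positivity) (inv_le_one_of_one_le₀ ?_)
      exact one_le_pow₀ (by have : 0 < 1 / t := by positivity
                            linarith)
  refine ⟨J.toReal, ENNReal.toReal_nonneg, fun r hr => ?_⟩
  rw [← lintegral_indicator measurableSet_Ioi, lintegral_scale _ hr, ENNReal.ofReal_mul ENNReal.toReal_nonneg,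
    ENNReal.ofReal_toReal hJfin.ne, hJ, ← lintegral_indicator measurableSet_Ioi,
    ← lintegral_const_mul' _ _ ENNReal.ofReal_ne_top, ← lintegral_mul_const' _ _ ENNReal.ofReal_ne_top]
  refine le_of_eq (lintegral_congr fun t => ?_)
  by_cases ht : 0 < t
  · have h1 : r • t ∈ Set.Ioi (0 : ℝ) := by simp only [smul_eq_mul, Set.mem_Ioi]; positivity
    rw [Set.indicator_of_mem h1, Set.indicator_of_mem (by exact ht), ← ENNReal.ofReal_mul (by positivity),
      ← ENNReal.ofReal_mul (by positivity)]
    congr 1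
    simp only [Module.finrank_self, pow_one, smul_eq_mul]
    rw [Real.mul_rpow hr.le ht.le, show r / (r * t) = 1 / t by field_simp]
    have : r * r ^ (-a - 1) = r ^ (-a) := by
      conv_lhs => rw [← Real.rpow_one_add' hr.le (by linarith)]
      congr 1; ring
    linear_combination (t ^ (-a - 1) * ((1 + 1 / t) ^ M)⁻¹) * this
  · have h1 : r • t ∉ Set.Ioi (0 : ℝ) := by
      simp only [smul_eq_mul, Set.mem_Ioi]
      push Not at ht ⊢
      exact mul_nonpos_of_nonneg_of_nonpos hr.le ht
    rw [Set.indicator_of_notMem h1, Set.indicator_of_notMem (by exact ht)]; simp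

lemma schwartz_decay (f : SchwartzMap X ℂ) (M : ℕ) :
    ∃ C : ℝ, 0 ≤ C ∧ ∀ z, ‖f z‖ ≤ C * ((1 + ‖z‖) ^ M)⁻¹ := by
  refine ⟨2 ^ M * ((Finset.Iic ((M, 0) : ℕ × ℕ)).sup fun m => SchwartzMap.seminorm ℝ m.1 m.2) f,
    ?_, fun z => ?_⟩
  rotate_left 1
  · have := SchwartzMap.one_add_le_sup_seminorm_apply (𝕜 := ℝ) (m := (M, 0)) (le_refl M) (le_refl 0) f z
    rw [norm_iteratedFDeriv_zero] at this
    rw [← div_eq_mul_inv, le_div_iff₀ (by positivity), mul_comm]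
    exact this
  · have : 0 ≤ ((Finset.Iic ((M, 0) : ℕ × ℕ)).sup fun m => SchwartzMap.seminorm ℝ m.1 m.2) f := apply_nonneg _ _
    positivity

lemma schwartz_decay_fderiv (f : SchwartzMap X ℂ) (M : ℕ) :
    ∃ C : ℝ, 0 ≤ C ∧ ∀ z, ‖fderiv ℝ f z‖ ≤ C * ((1 + ‖z‖) ^ M)⁻¹ := by
  refine ⟨2 ^ M * ((Finset.Iic ((M, 1) : ℕ × ℕ)).sup fun m => SchwartzMap.seminorm ℝ m.1 m.2) f,
    ?_, fun z => ?_⟩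
  rotate_left 1
  · have := SchwartzMap.one_add_le_sup_seminorm_apply (𝕜 := ℝ) (m := (M, 1)) (le_refl M) (le_refl 1) f z
    rw [norm_iteratedFDeriv_one] at this
    rw [← div_eq_mul_inv, le_div_iff₀ (by positivity), mul_comm]
    exact this
  · have : 0 ≤ ((Finset.Iic ((M, 1) : ℕ × ℕ)).sup fun m => SchwartzMap.seminorm ℝ m.1 m.2) f := apply_nonneg _ _
    positivity

lemma schwartz_lip (f : SchwartzMap X ℂ) :
    ∃ C : ℝ, 0 ≤ C ∧ ∀ z, ‖f z - f 0‖ ≤ C * ‖z‖ := by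
  obtain ⟨C, hC, h⟩ := schwartz_decay_fderiv f 0
  refine ⟨C, hC, fun z => ?_⟩
  have := Convex.norm_image_sub_le_of_norm_fderiv_le (𝕜 := ℝ) (f := f) (C := C) (s := Set.univ) (x := 0) (y := z)
    (fun x _ => f.differentiableAt) (fun x _ => by simpa using h x) convex_univ trivial trivial
  simpa using this

lemma schwartz_diff (f : SchwartzMap X ℂ) (M : ℕ) :
    ∃ C : ℝ, 0 ≤ C ∧ ∀ z w : X, 2 * ‖w‖ ≤ ‖z‖ →
      ‖f (z + w) - f z‖ ≤ C * ‖w‖ * ((1 + ‖z‖ / 2) ^ M)⁻¹ := by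
  obtain ⟨C, hC, h⟩ := schwartz_decay_fderiv f M
  refine ⟨C, hC, fun z w hw => ?_⟩
  have := Convex.norm_image_sub_le_of_norm_fderiv_le (𝕜 := ℝ) (f := f)
    (C := C * ((1 + ‖z‖ / 2) ^ M)⁻¹) (s := Metric.closedBall z (‖z‖ / 2)) (x := z) (y := z + w)
    (fun x _ => f.differentiableAt) (fun x hx => ?_) (convex_closedBall _ _)
    (by simp; positivity) (by simp; linarith)
  · refine this.trans (le_of_eq ?_)
    rw [add_sub_cancel_left]; ring
  · refine (h x).trans ?_
    have hx' : ‖z‖ / 2 ≤ ‖x‖ := by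
      rw [mem_closedBall_iff_norm] at hx
      have := norm_sub_norm_le z x
      rw [norm_sub_rev] at this
      linarith
    gcongr

variable {ι : Type*} [Fintype ι] [DecidableEq ι]

/-- The modified dyadic kernel. -/
def KK (Γ : ι → SchwartzMap X ℂ) (Ψ : ι → ι → SchwartzMap X ℂ) (j : ι) (t : ℝ) (x y : X) : ℂ :=
  Γ j (t⁻¹ • (y - x)) - ∑ i, Γ i (-(t⁻¹ • x)) * Ψ i j (‖x‖⁻¹ • y)

lemma two_weight {d a1 a2 : ℝ} (h1 : 0 < a1) (h2 : 0 < a2) {M : ℕ} (hM1 : a1 + 1 ≤ M)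
    (hM2 : a2 + 1 ≤ M) :
    ∃ C : ℝ, 0 ≤ C ∧ ∀ (F : ℝ → ℝ) (c1 c2 r1 r2 : ℝ), 0 ≤ c1 → 0 ≤ c2 → 0 < r1 → 0 < r2 →
      (∀ t, 0 < t → t ^ (-d - 1) * F t ≤ c1 * (t ^ (-a1 - 1) * ((1 + r1 / t) ^ M)⁻¹)
        + c2 * (t ^ (-a2 - 1) * ((1 + r2 / t) ^ M)⁻¹)) →
      ∫⁻ t in Set.Ioi (0 : ℝ), ENNReal.ofReal (t ^ (-d - 1) * F t)
        ≤ ENNReal.ofReal (C * (c1 * r1 ^ (-a1) + c2 * r2 ^ (-a2))) := by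
  obtain ⟨C1, hC1, H1⟩ := weight_int h1 hM1
  obtain ⟨C2, hC2, H2⟩ := weight_int h2 hM2
  refine ⟨C1 + C2, by positivity, fun F c1 c2 r1 r2 hc1 hc2 hr1 hr2 hF => ?_⟩
  calc _ ≤ ∫⁻ t in Set.Ioi (0 : ℝ), (ENNReal.ofReal c1 * ENNReal.ofReal (t ^ (-a1 - 1) * ((1 + r1 / t) ^ M)⁻¹)
        + ENNReal.ofReal c2 * ENNReal.ofReal (t ^ (-a2 - 1) * ((1 + r2 / t) ^ M)⁻¹)) := by
        refine setLIntegral_mono (by fun_prop) fun t ht => ?_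
        have ht : 0 < t := ht
        rw [← ENNReal.ofReal_mul hc1, ← ENNReal.ofReal_mul hc2, ← ENNReal.ofReal_add (by positivity) (by positivity)]
        exact ENNReal.ofReal_le_ofReal (hF t ht)
    _ ≤ ENNReal.ofReal c1 * ENNReal.ofReal (C1 * r1 ^ (-a1)) + ENNReal.ofReal c2 * ENNReal.ofReal (C2 * r2 ^ (-a2)) := by
        rw [lintegral_add_left (by fun_prop), lintegral_const_mul _ (by fun_prop), lintegral_const_mul _ (by fun_prop)]
        gcongr
        · exact H1 r1 hr1
        · exact H2 r2 hr2
    _ ≤ _ := by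
        rw [← ENNReal.ofReal_mul hc1, ← ENNReal.ofReal_mul hc2, ← ENNReal.ofReal_add (by positivity) (by positivity)]
        refine ENNReal.ofReal_le_ofReal ?_
        have e1 : 0 ≤ r1 ^ (-a1) := by positivity
        have e2 : 0 ≤ r2 ^ (-a2) := by positivity
        have := mul_nonneg hC2 (mul_nonneg hc1 e1)
        have := mul_nonneg hC1 (mul_nonneg hc2 e2)
        linarith

lemma KK_bound {d : ℝ} (hd : 0 < d) (Γ : ι → SchwartzMap X ℂ) (Ψ : ι → ι → SchwartzMap X ℂ)
    (hΨ : ∀ i j, Ψ i j 0 = if i = j then 1 else 0) (j : ι) :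
    ∃ C : ℝ, 0 ≤ C ∧ ∀ x y : X, x ≠ 0 → y ≠ x →
      ∫⁻ t in Set.Ioi (0 : ℝ), ENNReal.ofReal (t ^ (-d - 1) * ‖KK Γ Ψ j t x y‖)
        ≤ ENNReal.ofReal (C * kr d x y) := by
  obtain ⟨M, hM⟩ := exists_nat_ge (d + 2)
  obtain ⟨W1, hW1, HW1⟩ := two_weight (d := d) (a1 := d + 1) (a2 := d) (by linarith) hd (M := M) (by linarith) (by linarith)
  obtain ⟨W2, hW2, HW2⟩ := two_weight (d := d) (a1 := d) (a2 := d) hd hd (M := M) (by linarith) (by linarith)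
  choose D hD0 hD using fun i => schwartz_decay (Γ i) M
  obtain ⟨P, hP0, hP⟩ := schwartz_diff (Γ j) M
  choose Lc hL0 hL using fun i => schwartz_lip (Ψ i j)
  choose B hB0 hB using fun i => schwartz_decay (Ψ i j) M
  set S1 := ∑ i, D i * Lc i
  set S2 := ∑ i, D i * B i
  have hS1 : 0 ≤ S1 := Finset.sum_nonneg fun i _ => mul_nonneg (hD0 i) (hL0 i)
  have hS2 : 0 ≤ S2 := Finset.sum_nonneg fun i _ => mul_nonneg (hD0 i) (hB0 i)
  set C1 := W1 * (P * (1 / 2) ^ (-(d + 1)) + S1)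
  set C2 := W2 * (D j + S2 * 3 ^ d)
  have hC1 : 0 ≤ C1 := by positivity
  have hC2 : 0 ≤ C2 := by have := hD0 j; positivity
  refine ⟨C1 + C2, by positivity, fun x y hx hxy => ?_⟩
  have hx0 : 0 < ‖x‖ := norm_pos_iff.2 hx
  have hyx : 0 < ‖x - y‖ := norm_pos_iff.2 (sub_ne_zero.2 hxy.symm)
  have nt : ∀ t : ℝ, 0 < t → ∀ z : X, ‖t⁻¹ • z‖ = ‖z‖ / t := by
    intro t ht z
    rw [norm_smul, norm_inv, Real.norm_of_nonneg ht.le]; field_simp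
  have nx : ‖‖x‖⁻¹ • y‖ = ‖y‖ / ‖x‖ := by
    rw [norm_smul, norm_inv, norm_norm]; field_simp
  by_cases hc : 2 * ‖y‖ ≤ ‖x‖
  · have hk : kr d x y = ‖y‖ * ‖x‖ ^ (-(d + 1)) := by unfold kr; simp [hc]
    refine (HW1 (fun t => ‖KK Γ Ψ j t x y‖) (P * ‖y‖) (S1 * (‖y‖ / ‖x‖)) (‖x‖ / 2) ‖x‖
      (by positivity) (by positivity) (by positivity) hx0 ?_).trans ?_
    · intro t ht
      have e1 : ‖Γ j (t⁻¹ • (y - x)) - Γ j (-(t⁻¹ • x))‖ ≤ P * (‖y‖ / t) * ((1 + ‖x‖ / 2 / t) ^ M)⁻¹ := by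
        have := hP (-(t⁻¹ • x)) (t⁻¹ • y) (by rw [norm_neg, nt t ht, nt t ht, ← mul_div_assoc]; gcongr)
        rw [norm_neg, nt t ht, nt t ht] at this
        rw [show t⁻¹ • (y - x) = -(t⁻¹ • x) + t⁻¹ • y by rw [smul_sub]; abel, div_right_comm]
        exact this
      have e2 : ‖∑ i, Γ i (-(t⁻¹ • x)) * (Ψ i j 0 - Ψ i j (‖x‖⁻¹ • y))‖ ≤
          S1 * (‖y‖ / ‖x‖) * ((1 + ‖x‖ / t) ^ M)⁻¹ := by
        refine (norm_sum_le _ _).trans ?_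
        rw [Finset.sum_mul, Finset.sum_mul]
        refine Finset.sum_le_sum fun i _ => ?_
        rw [norm_mul, norm_sub_rev]
        have h1 := hD i (-(t⁻¹ • x))
        have h2 := hL i (‖x‖⁻¹ • y)
        rw [norm_neg, nt t ht] at h1
        rw [nx] at h2
        calc _ ≤ (D i * ((1 + ‖x‖ / t) ^ M)⁻¹) * (Lc i * (‖y‖ / ‖x‖)) :=
              mul_le_mul h1 h2 (norm_nonneg _) ((norm_nonneg _).trans h1)
          _ = _ := by ring
      have e3 : KK Γ Ψ j t x y = (Γ j (t⁻¹ • (y - x)) - Γ j (-(t⁻¹ • x))) +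
          ∑ i, Γ i (-(t⁻¹ • x)) * (Ψ i j 0 - Ψ i j (‖x‖⁻¹ • y)) := by
        unfold KK
        simp_rw [mul_sub, Finset.sum_sub_distrib, hΨ]
        simp
      rw [e3]
      calc _ ≤ t ^ (-d - 1) * (P * (‖y‖ / t) * ((1 + ‖x‖ / 2 / t) ^ M)⁻¹ + S1 * (‖y‖ / ‖x‖) * ((1 + ‖x‖ / t) ^ M)⁻¹) := by
            gcongr
            exact (norm_add_le _ _).trans (add_le_add e1 e2)
        _ = _ := by
            have : t ^ (-(d + 1) - 1) = t ^ (-d - 1) / t := by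
              rw [show -(d + 1) - 1 = (-d - 1) - 1 by ring, Real.rpow_sub_one ht.ne']
            rw [this]; ring
    · refine ENNReal.ofReal_le_ofReal ?_
      rw [hk]
      have : ‖x‖ ^ (-(d + 1)) = ‖x‖ ^ (-d) / ‖x‖ := by
        rw [show -(d + 1) = (-d) - 1 by ring, Real.rpow_sub_one hx0.ne']
      calc _ = C1 * (‖y‖ * ‖x‖ ^ (-(d + 1))) := by
            rw [show ‖x‖ / 2 = (1 / 2) * ‖x‖ by ring, Real.mul_rpow (by norm_num) hx0.le]
            simp only [C1]
            rw [this]; ring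
        _ ≤ _ := by
          have : 0 ≤ C2 * (‖y‖ * ‖x‖ ^ (-(d + 1))) := by positivity
          linarith
  · have hk : kr d x y = ‖x - y‖ ^ (-d) := by unfold kr; simp [hc]
    push Not at hc
    have hy0 : 0 < ‖y‖ := by linarith
    refine (HW2 (fun t => ‖KK Γ Ψ j t x y‖) (D j) (S2 * (‖y‖ / ‖x‖) ^ (-d)) ‖x - y‖ ‖x‖
      (hD0 j) (by positivity) (by positivity) hx0 ?_).trans ?_
    · intro t ht
      have e1 : ‖Γ j (t⁻¹ • (y - x))‖ ≤ D j * ((1 + ‖x - y‖ / t) ^ M)⁻¹ := by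
        have := hD j (t⁻¹ • (y - x))
        rwa [nt t ht, norm_sub_rev] at this
      have e2 : ‖∑ i, Γ i (-(t⁻¹ • x)) * Ψ i j (‖x‖⁻¹ • y)‖ ≤
          S2 * (‖y‖ / ‖x‖) ^ (-d) * ((1 + ‖x‖ / t) ^ M)⁻¹ := by
        refine (norm_sum_le _ _).trans ?_
        rw [Finset.sum_mul, Finset.sum_mul]
        refine Finset.sum_le_sum fun i _ => ?_
        rw [norm_mul]
        have h1 := hD i (-(t⁻¹ • x))
        have h2 := hB i (‖x‖⁻¹ • y)
        rw [norm_neg, nt t ht] at h1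
        rw [nx] at h2
        have h3 : ((1 + ‖y‖ / ‖x‖) ^ M)⁻¹ ≤ (‖y‖ / ‖x‖) ^ (-d) := by
          rw [Real.rpow_neg (by positivity)]
          refine inv_anti₀ (by positivity) ?_
          calc (‖y‖ / ‖x‖) ^ d ≤ (1 + ‖y‖ / ‖x‖) ^ d :=
                Real.rpow_le_rpow (by positivity) (by linarith) hd.le
            _ ≤ (1 + ‖y‖ / ‖x‖) ^ (M : ℝ) :=
                Real.rpow_le_rpow_of_exponent_le (by have : 0 < ‖y‖ / ‖x‖ := by positivity
                                                     linarith) (by linarith)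
            _ = _ := Real.rpow_natCast _ _
        have h4 : B i * ((1 + ‖y‖ / ‖x‖) ^ M)⁻¹ ≤ B i * (‖y‖ / ‖x‖) ^ (-d) :=
          mul_le_mul_of_nonneg_left h3 (hB0 i)
        calc _ ≤ (D i * ((1 + ‖x‖ / t) ^ M)⁻¹) * (B i * (‖y‖ / ‖x‖) ^ (-d)) :=
              mul_le_mul h1 (h2.trans h4) (norm_nonneg _) ((norm_nonneg _).trans h1)
          _ = _ := by ring
      calc _ ≤ t ^ (-d - 1) * (D j * ((1 + ‖x - y‖ / t) ^ M)⁻¹ + S2 * (‖y‖ / ‖x‖) ^ (-d) * ((1 + ‖x‖ / t) ^ M)⁻¹) := by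
            gcongr
            exact (norm_sub_le _ _).trans (add_le_add e1 e2)
        _ = _ := by ring
    · refine ENNReal.ofReal_le_ofReal ?_
      rw [hk]
      have h5 : (‖y‖ / ‖x‖) ^ (-d) * ‖x‖ ^ (-d) ≤ 3 ^ d * ‖x - y‖ ^ (-d) := by
        rw [← Real.mul_rpow (by positivity) hx0.le, div_mul_cancel₀ _ hx0.ne']
        have h6 : ‖x - y‖ ≤ 3 * ‖y‖ := by have := norm_sub_le x y; linarith
        rw [Real.rpow_neg hy0.le, Real.rpow_neg hyx.le, ← div_eq_mul_inv, inv_eq_one_div,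
          div_le_div_iff₀ (by positivity) (by positivity), one_mul, ← Real.mul_rpow (by norm_num) hy0.le]
        exact Real.rpow_le_rpow hyx.le h6 hd.le
      calc _ = W2 * (D j * ‖x - y‖ ^ (-d) + S2 * ((‖y‖ / ‖x‖) ^ (-d) * ‖x‖ ^ (-d))) := by ring
        _ ≤ W2 * (D j * ‖x - y‖ ^ (-d) + S2 * (3 ^ d * ‖x - y‖ ^ (-d))) := by gcongr
        _ = C2 * ‖x - y‖ ^ (-d) := by simp only [C2]; ring
        _ ≤ _ := by
          have : 0 ≤ C1 * ‖x - y‖ ^ (-d) := by positivity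
          linarith

end Part2

section Part3

set_option linter.unusedSectionVars false

open scoped FourierTransform ContDiff

/-- A one-dimensional bump function supported away from `0`. -/
def bmp : ContDiffBump (2 : ℝ) := ⟨1 / 2, 1, by norm_num, by norm_num⟩

lemma bmp_zero {s : ℝ} (hs : s ≤ 1 ∨ 3 ≤ s) : bmp s = 0 := by
  refine bmp.zero_of_le_dist ?_
  show (1 : ℝ) ≤ dist s 2
  rw [Real.dist_eq]
  rcases hs with h | h
  · rw [abs_of_nonpos (by linarith)]; linarith
  · rw [abs_of_nonneg (by linarith)]; linarith

/-- Normalisation constant. -/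
def cbmp : ℝ := ∫ t in Set.Ioi (0 : ℝ), t⁻¹ * bmp t

lemma bmp_cont : Continuous (fun t : ℝ => t⁻¹ * bmp t) := by
  rw [continuous_iff_continuousAt]
  intro t
  by_cases ht : t = 0
  · subst ht
    have : (fun t : ℝ => t⁻¹ * bmp t) =ᶠ[nhds 0] fun _ => 0 := by
      filter_upwards [Iio_mem_nhds (show (0 : ℝ) < 1 by norm_num)] with s hs
      rw [bmp_zero (Or.inl (le_of_lt hs)), mul_zero]
    exact continuousAt_const.congr this.symm
  · exact (continuousAt_inv₀ ht).mul bmp.continuous.continuousAt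

lemma bmp_int : Integrable (fun t : ℝ => t⁻¹ * bmp t) := by
  refine bmp_cont.integrable_of_hasCompactSupport ?_
  exact bmp.hasCompactSupport.mul_left

lemma cbmp_pos : 0 < cbmp := by
  unfold cbmp
  rw [setIntegral_pos_iff_support_of_nonneg_ae]
  · have : Set.Ioo (3 / 2 : ℝ) (5 / 2) ⊆ Function.support (fun t : ℝ => t⁻¹ * bmp t) ∩ Set.Ioi 0 := by
      intro t ht
      have h0 : 0 < t := by linarith [ht.1]
      refine ⟨?_, h0⟩
      have : 0 < bmp t := by
        refine bmp.pos_of_mem_ball ?_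
        show dist t 2 < 1
        rw [Real.dist_eq, abs_lt]
        constructor <;> linarith [ht.1, ht.2]
      simp only [Function.mem_support]
      positivity
    refine lt_of_lt_of_le ?_ (measure_mono this)
    rw [Real.volume_Ioo]; norm_num
  · filter_upwards [ae_restrict_mem measurableSet_Ioi] with t ht
    have : (0 : ℝ) < t := ht
    have := bmp.nonneg (x := t)
    simp only [Pi.zero_apply]
    positivity
  · exact bmp_int.integrableOn

lemma bmp_scale_int {r : ℝ} (hr : 0 < r) :
    IntegrableOn (fun t : ℝ => t⁻¹ * bmp (t * r)) (Set.Ioi 0) ∧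
    ∫ t in Set.Ioi (0 : ℝ), t⁻¹ * bmp (t * r) = cbmp := by
  have e : ∀ t : ℝ, t⁻¹ * bmp (t * r) = r * ((t * r)⁻¹ * bmp (t * r)) := by
    intro t
    rw [mul_inv]; field_simp
  simp_rw [e]
  constructor
  · refine Integrable.const_mul ?_ _
    exact (bmp_int.comp_mul_right' hr.ne').integrableOn
  · rw [integral_const_mul, integral_comp_mul_right_Ioi (fun t => t⁻¹ * bmp t) 0 hr, zero_mul]
    unfold cbmp
    rw [smul_eq_mul, ← mul_assoc, mul_inv_cancel₀ hr.ne', one_mul]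

variable {X : Type*} [NormedAddCommGroup X] [InnerProductSpace ℝ X] [FiniteDimensional ℝ X]
  [MeasurableSpace X] [BorelSpace X]

/-- The truncated multiplier. -/
def cutf (m : X → ℝ) (ξ : X) : ℂ := ((bmp ‖ξ‖ * m ξ : ℝ) : ℂ)

lemma cutf_contDiff {m : X → ℝ} (hm : ∀ ξ, ξ ≠ 0 → ContDiffAt ℝ ∞ m ξ) : ContDiff ℝ ∞ (cutf m) := by
  rw [contDiff_iff_contDiffAt]
  intro ξ
  by_cases h : ξ = 0
  · subst h
    have : cutf m =ᶠ[nhds 0] fun _ => 0 := by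
      filter_upwards [Metric.ball_mem_nhds (0 : X) one_pos] with s hs
      unfold cutf
      rw [bmp_zero (Or.inl (le_of_lt (by simpa using hs))), zero_mul, Complex.ofReal_zero]
    exact contDiffAt_const.congr_of_eventuallyEq this
  · unfold cutf
    refine Complex.ofRealCLM.contDiff.contDiffAt.comp ξ ?_
    refine ContDiffAt.mul ?_ (hm ξ h)
    exact (bmp.contDiff (n := ⊤)).contDiffAt.comp ξ (contDiffAt_norm ℝ h)

lemma cutf_supp (m : X → ℝ) : HasCompactSupport (cutf m) := by
  refine HasCompactSupport.intro (isCompact_closedBall (0 : X) 3) fun ξ hξ => ?_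
  unfold cutf
  rw [bmp_zero (Or.inr _), zero_mul, Complex.ofReal_zero]
  simp at hξ
  exact hξ.le

/-- The truncated multiplier as a Schwartz function. -/
def cuts (m : X → ℝ) (hm : ∀ ξ, ξ ≠ 0 → ContDiffAt ℝ ∞ m ξ) : SchwartzMap X ℂ :=
  (cutf_supp m).toSchwartzMap (cutf_contDiff hm)

@[simp] lemma cuts_apply (m : X → ℝ) (hm : ∀ ξ, ξ ≠ 0 → ContDiffAt ℝ ∞ m ξ) (ξ : X) :
    cuts m hm ξ = cutf m ξ := rfl

lemma fourier_swap (f : SchwartzMap X ℂ) {h : X → ℂ} (hh : Integrable h) :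
    ∫ ξ, 𝓕 f ξ * h ξ = ∫ y, f y * 𝓕 h y := by
  simpa using! VectorFourier.integral_bilin_fourierIntegral_eq_flip (ContinuousLinearMap.mul ℂ ℂ)
    (L := innerₗ X) Real.continuous_fourierChar continuous_inner f.integrable hh

lemma fourier_mod_scale (h : SchwartzMap X ℂ) {t : ℝ} (ht : 0 < t) (x y : X) :
    𝓕 (fun ξ : X => h (t • ξ) * (Real.fourierChar (inner ℝ ξ x) : ℂ)) y
      = ((t ^ Module.finrank ℝ X)⁻¹ : ℝ) * 𝓕 h (t⁻¹ • (y - x)) := by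
  rw [SchwartzMap.fourier_coe, Real.fourier_eq, Real.fourier_eq]
  have := Measure.integral_comp_smul_of_nonneg (volume : Measure X)
    (fun ξ : X => Real.fourierChar (-inner ℝ ξ (t⁻¹ • (y - x))) • h ξ) t (hR := ht.le)
  rw [Complex.real_smul] at this
  rw [← this]
  refine integral_congr_ae (Filter.Eventually.of_forall fun ξ => ?_)
  simp only [Circle.smul_def, smul_eq_mul]
  rw [inner_smul_left, inner_smul_right, inner_sub_right]
  have e : -((starRingEnd ℝ) t * (t⁻¹ * (inner ℝ ξ y - inner ℝ ξ x))) = -inner ℝ ξ y + inner ℝ ξ x := by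
    simp only [conj_trivial]
    field_simp; ring
  rw [e, AddChar.map_add_eq_mul, Circle.coe_mul]
  ring

lemma norm_char (r : ℝ) : ‖(Real.fourierChar r : ℂ)‖ = 1 := Circle.norm_coe _

lemma norm_mul_char (z : ℂ) (r : ℝ) : ‖z‖ = ‖z * (Real.fourierChar r : ℂ)‖ := by
  rw [norm_mul]
  exact ((congrArg (‖z‖ * ·) (norm_char r)).trans (mul_one _)).symm

lemma cutf_scale_int (m : X → ℝ) (hm : ∀ ξ, ξ ≠ 0 → ContDiffAt ℝ ∞ m ξ) {t : ℝ} (ht : 0 < t) (x : X) :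
    Integrable (fun ξ : X => cuts m hm (t • ξ) * (Real.fourierChar (inner ℝ ξ x) : ℂ)) := by
  have h1 : Integrable (fun ξ : X => cuts m hm (t • ξ)) := (cuts m hm).integrable.comp_smul ht.ne'
  refine (integrable_norm_iff ?_).1 ?_
  · refine h1.aestronglyMeasurable.mul ?_
    refine Continuous.aestronglyMeasurable ?_
    have := Real.continuous_fourierChar
    fun_prop
  · refine h1.norm.congr (Filter.Eventually.of_forall fun ξ => ?_)
    exact norm_mul_char _ _

/-- Calderón type reproducing formula, as an inequality. -/
lemma calderon [Nontrivial X] (g : SchwartzMap X ℂ) (x : X) :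
    ENNReal.ofReal cbmp * ‖g x‖ₑ ≤ ∫⁻ t in Set.Ioi (0 : ℝ), ENNReal.ofReal t⁻¹ *
      ‖∫ ξ : X, (bmp (t * ‖ξ‖) : ℂ) * (𝓕 g ξ * (Real.fourierChar (inner ℝ ξ x) : ℂ))‖ₑ := by
  set G : X → ℂ := fun ξ => 𝓕 g ξ * (Real.fourierChar (inner ℝ ξ x) : ℂ) with hG
  have hGc : Continuous G := by
    have := Real.continuous_fourierChar
    have := (𝓕 g).continuous
    fun_prop
  have hGi : Integrable G := by
    refine (integrable_norm_iff hGc.aestronglyMeasurable).1 ?_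
    refine (𝓕 g).integrable.norm.congr (Filter.Eventually.of_forall fun ξ => ?_)
    exact norm_mul_char _ _
  have hginv : g x = ∫ ξ, G ξ := by
    have h1 : 𝓕⁻ (𝓕 g) x = g x := by rw [FourierTransform.fourierInv_fourier_eq]
    rw [← h1, SchwartzMap.fourierInv_coe, Real.fourierInv_eq]
    refine integral_congr_ae (Filter.Eventually.of_forall fun ξ => ?_)
    simp only [Circle.smul_def, smul_eq_mul, G]
    ring
  have hξ0 : ∀ᵐ ξ : X, ξ ≠ 0 := by simp [ae_iff]
  set μ : Measure ℝ := volume.restrict (Set.Ioi (0 : ℝ))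
  set F : X → ℝ → ℂ := fun ξ t => ((t⁻¹ * bmp (t * ‖ξ‖) : ℝ) : ℂ) * G ξ with hF
  have hFi : Integrable (Function.uncurry F) ((volume : Measure X).prod μ) := by
    have hmeas : AEStronglyMeasurable (Function.uncurry F) ((volume : Measure X).prod μ) := by
      refine Measurable.aestronglyMeasurable ?_
      have h1 : Measurable (fun p : X × ℝ => G p.1) := hGc.measurable.comp measurable_fst
      have h2 : Measurable bmp := bmp.continuous.measurable
      unfold F Function.uncurry
      fun_prop
    rw [integrable_prod_iff hmeas]
    constructor
    · filter_upwards [hξ0] with ξ hξ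
      exact Integrable.mul_const (c := G ξ) ((bmp_scale_int (norm_pos_iff.2 hξ)).1.ofReal (𝕜 := ℂ))
    · refine (hGi.norm.const_mul cbmp).congr ?_
      filter_upwards [hξ0] with ξ hξ
      rw [← (bmp_scale_int (norm_pos_iff.2 hξ)).2, ← integral_mul_const]
      refine setIntegral_congr_fun measurableSet_Ioi fun t ht => ?_
      have ht : 0 < t := ht
      have := bmp.nonneg (x := t * ‖ξ‖)
      show t⁻¹ * bmp (t * ‖ξ‖) * ‖G ξ‖ = ‖((t⁻¹ * bmp (t * ‖ξ‖) : ℝ) : ℂ) * G ξ‖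
      generalize G ξ = w
      rw [norm_mul, Complex.norm_real, Real.norm_of_nonneg (by positivity)]
  have hsw := integral_integral_swap hFi
  have hl : ∫ ξ, ∫ t, F ξ t ∂μ = (cbmp : ℂ) * g x := by
    rw [hginv, ← integral_const_mul]
    refine integral_congr_ae ?_
    filter_upwards [hξ0] with ξ hξ
    simp only [F]
    rw [integral_mul_const, integral_complex_ofReal, (bmp_scale_int (norm_pos_iff.2 hξ)).2]
  have hr : ∀ t, ∫ ξ, F ξ t = ((t⁻¹ : ℝ) : ℂ) * ∫ ξ, (bmp (t * ‖ξ‖) : ℂ) * G ξ := by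
    intro t
    rw [← integral_const_mul]
    refine integral_congr_ae (Filter.Eventually.of_forall fun ξ => ?_)
    simp only [F]; push_cast; ring
  rw [hl] at hsw
  calc ENNReal.ofReal cbmp * ‖g x‖ₑ = ‖(cbmp : ℂ) * g x‖ₑ := by
        rw [enorm_mul, ← ofReal_norm (cbmp : ℂ), Complex.norm_real, Real.norm_of_nonneg cbmp_pos.le]
    _ = ‖∫ t, (∫ ξ, F ξ t) ∂μ‖ₑ := by rw [hsw]
    _ ≤ ∫⁻ t, ‖∫ ξ, F ξ t‖ₑ ∂μ := enorm_integral_le_lintegral_enorm _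
    _ = _ := by
        refine setLIntegral_congr_fun measurableSet_Ioi fun t ht => ?_
        have ht : 0 < t := ht
        simp only [hr]
        rw [enorm_mul, ← ofReal_norm ((t⁻¹ : ℝ) : ℂ), Complex.norm_real, Real.norm_of_nonneg (by positivity)]

end Part3

section Part4

set_option linter.unusedSectionVars false

open scoped FourierTransform ContDiff

variable {X : Type*} [NormedAddCommGroup X] [InnerProductSpace ℝ X] [FiniteDimensional ℝ X]
  [MeasurableSpace X] [BorelSpace X]
variable {ι : Type*} [Fintype ι] [DecidableEq ι]

lemma schwartz_mul_int (f : SchwartzMap X ℂ) {h : X → ℂ} (hh : Integrable h) :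
    Integrable (fun ξ => f ξ * h ξ) :=
  hh.bdd_mul (c := SchwartzMap.seminorm ℝ 0 0 f) f.continuous.aestronglyMeasurable
    (Filter.Eventually.of_forall fun ξ => SchwartzMap.norm_le_seminorm ℝ f ξ)

lemma schwartz_bdd_int (f : SchwartzMap X ℂ) (h : SchwartzMap X ℂ) {φ : X → X} (hφ : Continuous φ) :
    Integrable (fun ξ => f ξ * h (φ ξ)) := by
  refine f.integrable.mul_bdd (c := SchwartzMap.seminorm ℝ 0 0 h)
    (h.continuous.comp hφ).aestronglyMeasurable
    (Filter.Eventually.of_forall fun ξ => SchwartzMap.norm_le_seminorm ℝ h _)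

lemma step_A [Nontrivial X] {ℓ : ℕ} (m : ι → X → ℝ)
    (hm : ∀ i ξ, ξ ≠ 0 → ContDiffAt ℝ ∞ (m i) ξ)
    (hh : ∀ i (t : ℝ) ξ, 0 < t → ξ ≠ 0 → t ^ ℓ * m i (t • ξ) = m i ξ)
    (g : SchwartzMap X ℂ) (f : ι → SchwartzMap X ℂ)
    (hg : ∀ ξ, ξ ≠ 0 → 𝓕 g ξ = ∑ i, (m i ξ : ℂ) * 𝓕 (f i) ξ) {t : ℝ} (ht : 0 < t) (x : X) :
    ∫ ξ : X, (bmp (t * ‖ξ‖) : ℂ) * (𝓕 g ξ * (Real.fourierChar (inner ℝ ξ x) : ℂ))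
      = ((t ^ ℓ * (t ^ Module.finrank ℝ X)⁻¹ : ℝ) : ℂ) *
        ∑ i, ∫ y, f i y * 𝓕 (cuts (m i) (hm i)) (t⁻¹ • (y - x)) := by
  have hξ0 : ∀ᵐ ξ : X, ξ ≠ 0 := by simp [ae_iff]
  have e1 : ∫ ξ : X, (bmp (t * ‖ξ‖) : ℂ) * (𝓕 g ξ * (Real.fourierChar (inner ℝ ξ x) : ℂ))
      = ∫ ξ : X, ∑ i, ((t ^ ℓ : ℝ) : ℂ) *
        (𝓕 (f i) ξ * (cuts (m i) (hm i) (t • ξ) * (Real.fourierChar (inner ℝ ξ x) : ℂ))) := by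
    refine integral_congr_ae ?_
    filter_upwards [hξ0] with ξ hξ
    rw [hg ξ hξ, Finset.sum_mul, Finset.mul_sum]
    refine Finset.sum_congr rfl fun i _ => ?_
    rw [cuts_apply, cutf, norm_smul, Real.norm_of_nonneg ht.le, ← hh i t ξ ht hξ]
    push_cast
    ring
  rw [e1, integral_finsetSum]
  · rw [Finset.mul_sum]
    refine Finset.sum_congr rfl fun i _ => ?_
    rw [integral_const_mul, fourier_swap _ (cutf_scale_int (m i) (hm i) ht x)]
    rw [← integral_const_mul, ← integral_const_mul]
    refine integral_congr_ae (Filter.Eventually.of_forall fun y => ?_)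
    simp only [fourier_mod_scale _ ht]
    push_cast
    ring
  · intro i _
    exact (schwartz_mul_int _ (cutf_scale_int (m i) (hm i) ht x)).const_mul _

lemma step_B (Γ : ι → SchwartzMap X ℂ) (Ψ : ι → ι → SchwartzMap X ℂ) (f : ι → SchwartzMap X ℂ)
    (hf : ∀ R : ℝ, 0 < R → ∀ i, ∑ j, ∫ y, f j y * Ψ i j (R⁻¹ • y) = 0) {x : X} (hx : x ≠ 0) (t : ℝ) :
    ∑ i, ∫ y, f i y * Γ i (t⁻¹ • (y - x)) = ∑ j, ∫ y, f j y * KK Γ Ψ j t x y := by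
  have e : ∀ j, ∫ y, f j y * KK Γ Ψ j t x y = (∫ y, f j y * Γ j (t⁻¹ • (y - x)))
      - ∑ i, Γ i (-(t⁻¹ • x)) * ∫ y, f j y * Ψ i j (‖x‖⁻¹ • y) := by
    intro j
    have h1 : Integrable (fun y => f j y * Γ j (t⁻¹ • (y - x))) :=
      schwartz_bdd_int _ _ (by fun_prop)
    have h2 : ∀ i, Integrable (fun y => Γ i (-(t⁻¹ • x)) * (f j y * Ψ i j (‖x‖⁻¹ • y))) := fun i =>
      (schwartz_bdd_int _ _ (by fun_prop)).const_mul _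
    simp_rw [← integral_const_mul]
    rw [← integral_finsetSum _ (fun i _ => h2 i),
      ← integral_sub h1 (integrable_finsetSum _ (fun i _ => h2 i))]
    refine integral_congr_ae (Filter.Eventually.of_forall fun y => ?_)
    simp only [KK, mul_sub, Finset.mul_sum]
    congr 1
    refine Finset.sum_congr rfl fun i _ => by ring
  simp_rw [e]
  rw [Finset.sum_sub_distrib, Finset.sum_comm (f := fun j i => Γ i (-(t⁻¹ • x)) * _)]
  simp_rw [← Finset.mul_sum]
  have : ∀ i, ∑ j, ∫ y, f j y * Ψ i j (‖x‖⁻¹ • y) = 0 := hf _ (norm_pos_iff.2 hx)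
  simp [this]

lemma representation [Nontrivial X] {ℓ : ℕ} {d : ℝ} (hd : 0 < d)
    (hdl : d + ℓ = Module.finrank ℝ X) (m : ι → X → ℝ)
    (hm : ∀ i ξ, ξ ≠ 0 → ContDiffAt ℝ ∞ (m i) ξ)
    (hh : ∀ i (t : ℝ) ξ, 0 < t → ξ ≠ 0 → t ^ ℓ * m i (t • ξ) = m i ξ)
    (Ψ : ι → ι → SchwartzMap X ℂ) (hΨ : ∀ i j, Ψ i j 0 = if i = j then 1 else 0) :
    ∃ C : ℝ, 0 ≤ C ∧ ∀ (g : SchwartzMap X ℂ) (f : ι → SchwartzMap X ℂ),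
      (∀ ξ, ξ ≠ 0 → 𝓕 g ξ = ∑ i, (m i ξ : ℂ) * 𝓕 (f i) ξ) →
      (∀ R : ℝ, 0 < R → ∀ i, ∑ j, ∫ y, f j y * Ψ i j (R⁻¹ • y) = 0) →
      ∀ x, x ≠ 0 → ‖g x‖ₑ ≤ ENNReal.ofReal C *
        ∫⁻ y, ENNReal.ofReal (kr d x y) * ∑ j, ‖f j y‖ₑ := by
  set Γ : ι → SchwartzMap X ℂ := fun i => 𝓕 (cuts (m i) (hm i)) with hΓ
  choose c hc0 hc using fun j => KK_bound hd Γ Ψ hΨ j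
  refine ⟨cbmp⁻¹ * ∑ j, c j, by have := cbmp_pos; have := Finset.sum_nonneg (fun j (_ : j ∈ Finset.univ) => hc0 j); positivity, ?_⟩
  intro g f hg hf x hx
  have hKm : ∀ j, Measurable (fun p : ℝ × X => KK Γ Ψ j p.1 x p.2) := by
    intro j
    unfold KK
    have h1 : ∀ i, Measurable (Γ i) := fun i => (Γ i).continuous.measurable
    have h2 : ∀ i j, Measurable (Ψ i j) := fun i j => (Ψ i j).continuous.measurable
    fun_prop
  have hfm : ∀ j, Measurable (f j) := fun j => (f j).continuous.measurable
  have key : ENNReal.ofReal cbmp * ‖g x‖ₑ ≤ ENNReal.ofReal (∑ j, c j) *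
        ∫⁻ y, ENNReal.ofReal (kr d x y) * ∑ j, ‖f j y‖ₑ := by
    calc ENNReal.ofReal cbmp * ‖g x‖ₑ
        ≤ ∫⁻ t in Set.Ioi (0 : ℝ), ENNReal.ofReal t⁻¹ *
          ‖∫ ξ : X, (bmp (t * ‖ξ‖) : ℂ) * (𝓕 g ξ * (Real.fourierChar (inner ℝ ξ x) : ℂ))‖ₑ :=
          calderon g x
      _ ≤ ∫⁻ t in Set.Ioi (0 : ℝ), ∑ j, ∫⁻ y, ‖f j y‖ₑ * ENNReal.ofReal (t ^ (-d - 1) * ‖KK Γ Ψ j t x y‖) := by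
          refine setLIntegral_mono' measurableSet_Ioi fun t ht => ?_
          have ht : 0 < t := ht
          rw [step_A m hm hh g f hg ht x, step_B Γ Ψ f hf hx t, enorm_mul, ← mul_assoc]
          have e1 : ENNReal.ofReal t⁻¹ * ‖((t ^ ℓ * (t ^ Module.finrank ℝ X)⁻¹ : ℝ) : ℂ)‖ₑ
              = ENNReal.ofReal (t ^ (-d - 1)) := by
            rw [← ofReal_norm, Complex.norm_real, Real.norm_of_nonneg (by positivity),
              ← ENNReal.ofReal_mul (by positivity)]
            congr 1
            have : (-d - 1 : ℝ) = -1 + (ℓ + -(Module.finrank ℝ X : ℝ)) := by rw [← hdl]; ring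
            rw [this, Real.rpow_add ht, Real.rpow_add ht, Real.rpow_neg ht.le, Real.rpow_neg ht.le,
              Real.rpow_one, Real.rpow_natCast, Real.rpow_natCast]
          rw [e1]
          calc _ ≤ ENNReal.ofReal (t ^ (-d - 1)) * ∑ j, ∫⁻ y, ‖f j y * KK Γ Ψ j t x y‖ₑ := by
                gcongr
                refine (enorm_sum_le _ _).trans ?_
                gcongr
                exact enorm_integral_le_lintegral_enorm _
            _ = _ := by
                rw [Finset.mul_sum]
                refine Finset.sum_congr rfl fun j _ => ?_
                rw [← lintegral_const_mul' _ _ ENNReal.ofReal_ne_top]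
                refine lintegral_congr fun y => ?_
                rw [enorm_mul, ENNReal.ofReal_mul (by positivity), ofReal_norm]
                ring
      _ = ∑ j, ∫⁻ t in Set.Ioi (0 : ℝ), ∫⁻ y, ‖f j y‖ₑ * ENNReal.ofReal (t ^ (-d - 1) * ‖KK Γ Ψ j t x y‖) := by
          refine lintegral_finsetSum' _ fun j _ => ?_
          refine Measurable.aemeasurable ?_
          have := hKm j
          have := hfm j
          refine Measurable.lintegral_prod_right' (f := fun p : ℝ × X => ‖f j p.2‖ₑ * ENNReal.ofReal (p.1 ^ (-d - 1) * ‖KK Γ Ψ j p.1 x p.2‖)) ?_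
          fun_prop
      _ = ∑ j, ∫⁻ y, ∫⁻ t in Set.Ioi (0 : ℝ), ‖f j y‖ₑ * ENNReal.ofReal (t ^ (-d - 1) * ‖KK Γ Ψ j t x y‖) := by
          refine Finset.sum_congr rfl fun j _ => ?_
          refine lintegral_lintegral_swap ?_
          refine Measurable.aemeasurable ?_
          have := hKm j
          have := hfm j
          unfold Function.uncurry
          fun_prop
      _ ≤ ∑ j, ∫⁻ y, ENNReal.ofReal (∑ j, c j) * (ENNReal.ofReal (kr d x y) * ‖f j y‖ₑ) := by
          refine Finset.sum_le_sum fun j _ => ?_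
          have hyx : ∀ᵐ y : X, y ≠ x := by simp [ae_iff]
          refine lintegral_mono_ae ?_
          filter_upwards [hyx] with y hy
          rw [lintegral_const_mul' _ _ enorm_ne_top, mul_comm, ← mul_assoc]
          gcongr
          refine (hc j x y hx hy).trans ?_
          rw [← ENNReal.ofReal_mul (Finset.sum_nonneg fun j _ => hc0 j)]
          refine ENNReal.ofReal_le_ofReal ?_
          refine mul_le_mul_of_nonneg_right ?_ (kr_nonneg _ _ _)
          exact Finset.single_le_sum (fun j _ => hc0 j) (Finset.mem_univ j)
      _ = _ := by
          simp_rw [lintegral_const_mul' _ _ ENNReal.ofReal_ne_top]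
          rw [← Finset.mul_sum, ← lintegral_finsetSum]
          · simp_rw [Finset.mul_sum]
          · intro j _
            have := hfm j
            have : Measurable (fun y => kr d x y) := (kr_measurable d).comp (measurable_const.prodMk measurable_id)
            fun_prop
  rw [ENNReal.ofReal_mul (by have := cbmp_pos; positivity), ENNReal.ofReal_inv_of_pos cbmp_pos, mul_assoc,
    ← ENNReal.div_eq_inv_mul, ENNReal.le_div_iff_mul_le, mul_comm]
  · exact key
  · left; simpa using cbmp_pos
  · left; exact ENNReal.ofReal_ne_top

end Part4

section Part5

set_option linter.unusedSectionVars false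

open scoped FourierTransform ContDiff

variable {X : Type*} [NormedAddCommGroup X] [InnerProductSpace ℝ X] [FiniteDimensional ℝ X]
  [MeasurableSpace X] [BorelSpace X]
variable {V E : Type*} [NormedAddCommGroup V] [InnerProductSpace ℝ V] [FiniteDimensional ℝ V]
    [NormedAddCommGroup E] [InnerProductSpace ℝ E] [FiniteDimensional ℝ E]

lemma symbol_pkg {k : ℕ} (S : X → V →L[ℝ] E) (hS : ContDiff ℝ ∞ S)
    (hk : ∀ (t : ℝ) ξ, S (t • ξ) = t ^ k • S ξ)
    (hinj : ∀ ξ, ξ ≠ 0 → Function.Injective (S ξ)) :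
    ∃ (P : X → E →L[ℝ] V) (Q : X → E →L[ℝ] E),
      (∀ ξ, ξ ≠ 0 → ContDiffAt ℝ ∞ P ξ) ∧ (∀ ξ, ξ ≠ 0 → ContDiffAt ℝ ∞ Q ξ) ∧
      (∀ ξ, ξ ≠ 0 → ∀ v, P ξ (S ξ v) = v) ∧
      (∀ ξ, ξ ≠ 0 → ∀ v, Q ξ (S ξ v) = 0) ∧
      (∀ (t : ℝ) ξ, 0 < t → ξ ≠ 0 → t ^ k • P (t • ξ) = P ξ) ∧
      (∀ (t : ℝ) ξ, 0 < t → ξ ≠ 0 → Q (t • ξ) = Q ξ) ∧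
      (∀ ξ, ξ ≠ 0 → ∀ e, inner ℝ e (Q ξ e) = ‖Q ξ e‖ ^ 2) ∧
      (∀ ξ, ξ ≠ 0 → ∀ e, Q ξ e = 0 → e ∈ Set.range (S ξ)) := by
  set B : X → V →L[ℝ] V := fun ξ => (ContinuousLinearMap.adjoint (S ξ)).comp (S ξ) with hB
  have hBv : ∀ ξ v, B ξ v = ContinuousLinearMap.adjoint (S ξ) (S ξ v) := fun ξ v => rfl
  have hBinj : ∀ ξ, ξ ≠ 0 → Function.Injective (B ξ) := by
    intro ξ hξ
    rw [injective_iff_map_eq_zero]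
    intro v hv
    have h1 : inner ℝ (B ξ v) v = ‖S ξ v‖ ^ 2 := by
      rw [← real_inner_self_eq_norm_sq, hBv, ContinuousLinearMap.adjoint_inner_left]
    rw [hv, inner_zero_left] at h1
    have : S ξ v = 0 := by
      have := pow_eq_zero_iff (two_ne_zero) |>.1 h1.symm
      simpa using this
    exact (injective_iff_map_eq_zero _).1 (hinj ξ hξ) v this
  have hBe : ∀ ξ, ξ ≠ 0 → ∃ e : V ≃L[ℝ] V, (e : V →L[ℝ] V) = B ξ := by
    intro ξ hξ
    refine ⟨(LinearEquiv.ofInjectiveEndo (B ξ : V →ₗ[ℝ] V) (hBinj ξ hξ)).toContinuousLinearEquiv, ?_⟩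
    ext v; rfl
  set P : X → E →L[ℝ] V := fun ξ => ((B ξ).inverse).comp (ContinuousLinearMap.adjoint (S ξ)) with hP
  have hBP : ∀ ξ, ξ ≠ 0 → ∀ w, B ξ (P ξ w) = ContinuousLinearMap.adjoint (S ξ) w := by
    intro ξ hξ w
    obtain ⟨e, he⟩ := hBe ξ hξ
    simp only [hP, ContinuousLinearMap.comp_apply, ← he, ContinuousLinearMap.inverse_equiv]
    simp
  have hadj : ContDiff ℝ ∞ (fun ξ => ContinuousLinearMap.adjoint (S ξ)) := by
    exact (ContinuousLinearMap.adjoint (𝕜 := ℝ) (E := V) (F := E)).toContinuousLinearEquiv.contDiff.comp hS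
  have hBs : ContDiff ℝ ∞ B := hadj.clm_comp hS
  have hPs : ∀ ξ, ξ ≠ 0 → ContDiffAt ℝ ∞ P ξ := by
    intro ξ hξ
    obtain ⟨e, he⟩ := hBe ξ hξ
    refine ContDiffAt.clm_comp ?_ hadj.contDiffAt
    have h1 : ContDiffAt ℝ ∞ (ContinuousLinearMap.inverse : (V →L[ℝ] V) → V →L[ℝ] V) (B ξ) := by
      rw [← he]
      exact contDiffAt_map_inverse e
    exact ContDiffAt.comp ξ h1 hBs.contDiffAt
  have hPS : ∀ ξ, ξ ≠ 0 → ∀ v, P ξ (S ξ v) = v := by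
    intro ξ hξ v
    apply hBinj ξ hξ
    rw [hBP ξ hξ]
    rfl
  have hPh : ∀ (t : ℝ) ξ, 0 < t → ξ ≠ 0 → t ^ k • P (t • ξ) = P ξ := by
    intro t ξ ht hξ
    ext w
    apply hBinj ξ hξ
    have h1 := hBP (t • ξ) (smul_ne_zero ht.ne' hξ) w
    have h2 : ∀ v, B (t • ξ) v = t ^ k • t ^ k • B ξ v := by
      intro v
      simp only [hB, hk]
      simp
    have h3 : ContinuousLinearMap.adjoint (S (t • ξ)) w = t ^ k • ContinuousLinearMap.adjoint (S ξ) w := by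
      simp [hk]
    rw [h2, h3] at h1
    have h4 := smul_right_injective V (pow_ne_zero k ht.ne') h1
    rw [hBP ξ hξ w, ← h4]
    simp
  refine ⟨P, fun ξ => ContinuousLinearMap.id ℝ E - (S ξ).comp (P ξ), hPs, ?_, hPS, ?_, hPh, ?_, ?_, ?_⟩
  · intro ξ hξ
    exact contDiffAt_const.sub (hS.contDiffAt.clm_comp (hPs ξ hξ))
  · intro ξ hξ v
    simp [hPS ξ hξ]
  · intro t ξ ht hξ
    simp only
    rw [hk, ← hPh t ξ ht hξ]
    ext w; simp
  · intro ξ hξ e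
    simp only [sub_apply, ContinuousLinearMap.id_apply, ContinuousLinearMap.comp_apply]
    set r := e - S ξ (P ξ e) with hr
    have h0 : inner ℝ (S ξ (P ξ e)) r = 0 := by
      rw [← ContinuousLinearMap.adjoint_inner_right]
      have : ContinuousLinearMap.adjoint (S ξ) r = 0 := by
        rw [hr, map_sub, ← hBP ξ hξ e]
        simp [hB]
      rw [this, inner_zero_right]
    have h1 : e = S ξ (P ξ e) + r := by rw [hr]; abel
    rw [← real_inner_self_eq_norm_sq]
    conv_lhs => rw [h1]
    rw [inner_add_left, h0, zero_add]
  · intro ξ hξ e he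
    refine ⟨P ξ e, ?_⟩
    simp only [sub_apply, ContinuousLinearMap.id_apply, ContinuousLinearMap.comp_apply] at he
    exact (sub_eq_zero.1 he).symm

variable {ι : Type*} [Fintype ι] [DecidableEq ι]

lemma Psi_exists (q : ι → ι → X → ℝ) (hq : ∀ i j ξ, ξ ≠ 0 → ContDiffAt ℝ ∞ (q i j) ξ)
    (hh : ∀ i j (t : ℝ) ξ, 0 < t → ξ ≠ 0 → q i j (t • ξ) = q i j ξ) [Nontrivial X]
    (hinv : ∀ c : ι → ℝ, (∀ i, ∑ j, (∫ ξ, bmp ‖ξ‖ * q i j ξ) * c j = 0) → c = 0) :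
    ∃ Ψ : ι → ι → SchwartzMap X ℂ, (∀ i j, Ψ i j 0 = if i = j then 1 else 0) ∧
      ∀ f : ι → SchwartzMap X ℂ, (∀ ξ, ξ ≠ 0 → ∀ i, ∑ j, (q i j ξ : ℂ) * 𝓕 (f j) ξ = 0) →
      ∀ R : ℝ, 0 < R → ∀ i, ∑ j, ∫ y, f j y * Ψ i j (R⁻¹ • y) = 0 := by
  set M : Matrix ι ι ℝ := Matrix.of fun i j => ∫ ξ, bmp ‖ξ‖ * q i j ξ with hM
  have hMi : Function.Injective M.mulVec := by
    rw [← Matrix.coe_mulVecLin, injective_iff_map_eq_zero]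
    intro c hc
    refine hinv c fun i => ?_
    exact congrFun hc i
  have hMu : IsUnit M := Matrix.mulVec_injective_iff_isUnit.1 hMi
  have hMM : M⁻¹ * M = 1 := Matrix.nonsing_inv_mul _ ((Matrix.isUnit_iff_isUnit_det _).1 hMu)
  set Φ : ι → ι → SchwartzMap X ℂ := fun l j => 𝓕 (cuts (q l j) (hq l j)) with hΦ
  have hΦ0 : ∀ l j, Φ l j 0 = (M l j : ℂ) := by
    intro l j
    simp only [hΦ]
    rw [SchwartzMap.fourier_coe, Real.fourier_eq]
    simp only [inner_zero_right, neg_zero, AddChar.map_zero_eq_one, one_smul, cuts_apply, cutf, hM, Matrix.of_apply]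
    exact integral_complex_ofReal
  refine ⟨fun i j => ∑ l, ((M⁻¹ i l : ℝ) : ℂ) • Φ l j, ?_, ?_⟩
  · intro i j
    have : ∑ l, ((M⁻¹ i l : ℝ) : ℂ) * (M l j : ℂ) = ((M⁻¹ * M) i j : ℝ) := by
      rw [Matrix.mul_apply]; push_cast; rfl
    simp only [sum_apply, smul_apply, smul_eq_mul, hΦ0]
    rw [this, hMM, Matrix.one_apply]
    split_ifs <;> simp
  · intro f hf R hR i
    have h1 : ∀ l, ∑ j, ∫ y, f j y * Φ l j (R⁻¹ • y) = 0 := by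
      intro l
      have e1 : ∀ j, ∫ y, f j y * Φ l j (R⁻¹ • y) = ((R ^ Module.finrank ℝ X : ℝ) : ℂ) *
          ∫ ξ, 𝓕 (f j) ξ * (cuts (q l j) (hq l j) (R • ξ) * (Real.fourierChar (inner ℝ ξ (0 : X)) : ℂ)) := by
        intro j
        rw [fourier_swap _ (cutf_scale_int (q l j) (hq l j) hR 0), ← integral_const_mul]
        refine integral_congr_ae (Filter.Eventually.of_forall fun y => ?_)
        simp only [fourier_mod_scale _ hR, sub_zero, hΦ]
        have : (R : ℂ) ^ Module.finrank ℝ X ≠ 0 := pow_ne_zero _ (by exact_mod_cast hR.ne')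
        push_cast
        field_simp
      simp_rw [e1]
      rw [← Finset.mul_sum, ← integral_finsetSum]
      · rw [mul_eq_zero]; right
        refine integral_eq_zero_of_ae ?_
        have hξ0 : ∀ᵐ ξ : X, ξ ≠ 0 := by simp [ae_iff]
        filter_upwards [hξ0] with ξ hξ
        have h2 := hf ξ hξ l
        have : ∀ j, 𝓕 (f j) ξ * (cuts (q l j) (hq l j) (R • ξ) * (Real.fourierChar (inner ℝ ξ (0 : X)) : ℂ))
          = ((bmp ‖R • ξ‖ : ℂ) * (Real.fourierChar (inner ℝ ξ (0 : X)) : ℂ)) * ((q l j ξ : ℂ) * 𝓕 (f j) ξ) := by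
          intro j
          rw [cuts_apply, cutf, hh l j R ξ hR hξ]
          push_cast; ring
        simp_rw [this]
        rw [← Finset.mul_sum, h2, mul_zero]
        rfl
      · intro j _
        exact schwartz_mul_int _ (cutf_scale_int (q l j) (hq l j) hR 0)
    have h3 : ∀ j, ∫ y, f j y * (∑ l, ((M⁻¹ i l : ℝ) : ℂ) • Φ l j) (R⁻¹ • y)
        = ∑ l, ((M⁻¹ i l : ℝ) : ℂ) * ∫ y, f j y * Φ l j (R⁻¹ • y) := by
      intro j
      simp_rw [← integral_const_mul]
      rw [← integral_finsetSum]
      · refine integral_congr_ae (Filter.Eventually.of_forall fun y => ?_)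
        simp only [sum_apply, smul_apply, smul_eq_mul, Finset.mul_sum]
        refine Finset.sum_congr rfl fun l _ => by ring
      · intro l _
        exact (schwartz_bdd_int _ _ (by fun_prop)).const_mul _
    simp_rw [h3]
    rw [Finset.sum_comm]
    simp_rw [← Finset.mul_sum, h1]
    simp

lemma S_inj [Nontrivial X] (b : OrthonormalBasis ι ℝ E) {k : ℕ} (S : X → V →L[ℝ] E)
    (hk : ∀ (t : ℝ) ξ, S (t • ξ) = t ^ k • S ξ) (Q : X → E →L[ℝ] E)
    (hQs : ∀ ξ, ξ ≠ 0 → ContDiffAt ℝ ∞ Q ξ)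
    (hQ : ∀ ξ, ξ ≠ 0 → ∀ e, inner ℝ e (Q ξ e) = ‖Q ξ e‖ ^ 2)
    (hQr : ∀ ξ, ξ ≠ 0 → ∀ e, Q ξ e = 0 → e ∈ Set.range (S ξ))
    (hcan : (⋂ (ξ : X) (_ : ξ ≠ 0), Set.range (S ξ)) = {0})
    (c : ι → ℝ) (hc : ∀ i, ∑ j, (∫ ξ, bmp ‖ξ‖ * inner ℝ (b i) (Q ξ (b j))) * c j = 0) : c = 0 := by
  have hqs : ∀ i j, ∀ ξ : X, ξ ≠ 0 → ContDiffAt ℝ ∞ (fun ξ => inner ℝ (b i) (Q ξ (b j))) ξ := by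
    intro i j ξ hξ
    exact contDiffAt_const.inner ℝ ((hQs ξ hξ).clm_apply contDiffAt_const)
  have hint : ∀ i j, Integrable (fun ξ => bmp ‖ξ‖ * inner ℝ (b i) (Q ξ (b j))) := by
    intro i j
    exact (cuts _ (hqs i j)).integrable.re
  have hcont : ∀ i j, Continuous (fun ξ => bmp ‖ξ‖ * inner ℝ (b i) (Q ξ (b j))) := by
    intro i j
    exact Complex.continuous_re.comp (cuts _ (hqs i j)).continuous
  set e : E := ∑ j, c j • b j with he
  have hexp : ∀ ξ, bmp ‖ξ‖ * inner ℝ e (Q ξ e)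
      = ∑ i, c i * ∑ j, (bmp ‖ξ‖ * inner ℝ (b i) (Q ξ (b j))) * c j := by
    intro ξ
    rw [he]
    simp only [map_sum, map_smul, sum_inner, inner_sum, inner_smul_left, inner_smul_right,
      Finset.mul_sum, conj_trivial]
    rw [Finset.sum_comm]
    refine Finset.sum_congr rfl fun i _ => Finset.sum_congr rfl fun j _ => ?_
    ring
  have hz : ∫ ξ, bmp ‖ξ‖ * inner ℝ e (Q ξ e) = 0 := by
    simp_rw [hexp]
    rw [integral_finsetSum]
    · refine Finset.sum_eq_zero fun i _ => ?_
      rw [integral_const_mul, integral_finsetSum]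
      · simp_rw [integral_mul_const]
        rw [hc i, mul_zero]
      · intro j _; exact (hint i j).mul_const _
    · intro i _
      exact (integrable_finsetSum _ fun j _ => (hint i j).mul_const _).const_mul _
  have hci : Integrable (fun ξ => bmp ‖ξ‖ * inner ℝ e (Q ξ e)) := by
    simp_rw [hexp]
    exact integrable_finsetSum _ fun i _ =>
      (integrable_finsetSum _ fun j _ => (hint i j).mul_const _).const_mul _
  have hcc : Continuous (fun ξ => bmp ‖ξ‖ * inner ℝ e (Q ξ e)) := by
    simp_rw [hexp]
    have := hcont
    fun_prop
  have hnn : ∀ ξ, 0 ≤ bmp ‖ξ‖ * inner ℝ e (Q ξ e) := by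
    intro ξ
    by_cases h : ξ = 0
    · subst h; rw [bmp_zero (by simp)]; simp
    · rw [hQ ξ h]
      have := bmp.nonneg (x := ‖ξ‖)
      positivity
  have hzero : (fun ξ => bmp ‖ξ‖ * inner ℝ e (Q ξ e)) = 0 := by
    rw [integral_eq_zero_iff_of_nonneg hnn hci] at hz
    exact Continuous.ae_eq_iff_eq volume hcc continuous_zero |>.1 hz
  have hmem : e ∈ (⋂ (ξ : X) (_ : ξ ≠ 0), Set.range (S ξ)) := by
    simp only [Set.mem_iInter]
    intro ξ hξ
    have hn : 0 < ‖ξ‖ := norm_pos_iff.2 hξ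
    set t : ℝ := 2 / ‖ξ‖ with ht
    have htp : 0 < t := by positivity
    have h2 : ‖t • ξ‖ = 2 := by
      rw [norm_smul, Real.norm_of_nonneg htp.le, ht]; field_simp
    have hne : t • ξ ≠ 0 := smul_ne_zero htp.ne' hξ
    have h3 := congrFun hzero (t • ξ)
    simp only [h2, Pi.zero_apply] at h3
    have h4 : bmp 2 = 1 := bmp.one_of_mem_closedBall (by simp [bmp])
    rw [h4, one_mul, hQ _ hne] at h3
    have h5 : Q (t • ξ) e = 0 := by simpa using h3
    obtain ⟨v, hv⟩ := hQr _ hne e h5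
    refine ⟨t ^ k • v, ?_⟩
    rw [← hv, hk]; simp
  rw [hcan, Set.mem_singleton_iff] at hmem
  ext j
  have := b.repr_self
  have h6 : inner ℝ (b j) e = c j := by
    rw [he]
    exact b.orthonormal.inner_right_fintype c j
  rw [← h6, hmem]; simp

end Part5

section Part6

set_option linter.unusedSectionVars false

open scoped FourierTransform ContDiff LineDeriv

variable {X : Type*} [NormedAddCommGroup X] [InnerProductSpace ℝ X] [FiniteDimensional ℝ X]
  [MeasurableSpace X] [BorelSpace X]
variable {V E : Type*} [NormedAddCommGroup V] [InnerProductSpace ℝ V] [FiniteDimensional ℝ V]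
    [NormedAddCommGroup E] [InnerProductSpace ℝ E] [FiniteDimensional ℝ E]
variable {κ : Type*} [Fintype κ] [DecidableEq κ] {η : Type*} [Fintype η] [DecidableEq η]
  {ι : Type*} [Fintype ι] [DecidableEq ι]

lemma fourier_iter (f : SchwartzMap X ℂ) {p : ℕ} (w : Fin p → X) (ξ : X) :
    𝓕 (∂^{w} f) ξ = (2 * Real.pi * Complex.I) ^ p * ((∏ a, inner ℝ ξ (w a) : ℝ) : ℂ) * 𝓕 f ξ := by
  induction p with
  | zero => simp
  | succ p ih =>
    rw [LineDeriv.iteratedLineDerivOp_succ_left, SchwartzMap.fourier_lineDerivOp_eq, smul_apply,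
      SchwartzMap.smulLeftCLM_apply_apply (by fun_prop), ih, Fin.prod_univ_succ, pow_succ]
    simp only [smul_eq_mul, Complex.real_smul, Fin.tail]
    push_cast
    ring

/-- The elementary multilinear maps. -/
def elemT (e : OrthonormalBasis κ ℝ X) {p : ℕ} (r : Fin p → κ) (v : V) :
    ContinuousMultilinearMap ℝ (fun _ : Fin p => X) V :=
  (ContinuousMultilinearMap.mkPiRing ℝ (Fin p) v).compContinuousLinearMap
    (fun a => innerSL ℝ (e (r a)))

lemma elemT_apply (e : OrthonormalBasis κ ℝ X) {p : ℕ} (r : Fin p → κ) (v : V) (w : Fin p → X) :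
    elemT e r v w = (∏ a, inner ℝ (e (r a)) (w a)) • v := by
  simp [elemT]

lemma expand (e : OrthonormalBasis κ ℝ X) (v : OrthonormalBasis η ℝ V) {p : ℕ}
    (M : ContinuousMultilinearMap ℝ (fun _ : Fin p => X) V) :
    M = ∑ r : Fin p → κ, ∑ j, (inner ℝ (v j) (M fun a => e (r a))) • elemT e r (v j) := by
  apply ContinuousMultilinearMap.toMultilinearMap_injective
  refine Module.Basis.ext_multilinear (fun _ => e.toBasis) fun s => ?_
  simp only [OrthonormalBasis.coe_toBasis, ContinuousMultilinearMap.coe_coe]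
  rw [sum_apply]
  simp only [sum_apply, smul_apply, elemT_apply]
  rw [Finset.sum_eq_single s]
  · simp only [OrthonormalBasis.inner_eq_one, Finset.prod_const_one, one_smul]
    exact (v.sum_repr' _).symm
  · intro r _ hr
    obtain ⟨a, ha⟩ := Function.ne_iff.1 hr
    have : ∏ a, inner ℝ (e (r a)) (e (s a)) = 0 := by
      refine Finset.prod_eq_zero (Finset.mem_univ a) ?_
      exact e.inner_eq_zero ha
    simp [this]
  · simp

lemma symbol_eq {k : ℕ} (A : DiffOperator X k V E) (e : OrthonormalBasis κ ℝ X)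
    (v : OrthonormalBasis η ℝ V) (ξ : X) (z : V) :
    A.symbol ξ z = ∑ r : Fin k → κ, ∑ j, ((∏ a, inner ℝ ξ (e (r a))) * inner ℝ (v j) z) • A (elemT e r (v j)) := by
  have h1 : ∃ M : ContinuousMultilinearMap ℝ (fun _ : Fin k => X) V, A.symbol ξ z = A M ∧
      ∀ w, M w = (∏ a, inner ℝ ξ (w a)) • z := by
    refine ⟨_, rfl, fun w => ?_⟩
    simp [ContinuousMultilinearMap.piFieldEquiv]
  obtain ⟨M, hM, hMw⟩ := h1
  rw [hM, expand e v M, map_sum]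
  refine Finset.sum_congr rfl fun r _ => ?_
  rw [map_sum]
  refine Finset.sum_congr rfl fun j _ => ?_
  rw [map_smul, hMw, inner_smul_right]

lemma symbol_smooth {k : ℕ} (A : DiffOperator X k V E) : ContDiff ℝ ∞ A.symbol := by
  rw [contDiff_clm_apply_iff]
  intro z
  simp_rw [symbol_eq A (stdOrthonormalBasis ℝ X) (stdOrthonormalBasis ℝ V)]
  refine ContDiff.sum fun r _ => ContDiff.sum fun j _ => ContDiff.smul (ContDiff.mul ?_ contDiff_const) contDiff_const
  refine contDiff_prod fun a _ => ?_
  exact contDiff_id.inner ℝ contDiff_const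

lemma symbol_homog {k : ℕ} (A : DiffOperator X k V E) (t : ℝ) (ξ : X) :
    A.symbol (t • ξ) = t ^ k • A.symbol ξ := by
  ext z
  simp_rw [smul_apply, symbol_eq A (stdOrthonormalBasis ℝ X) (stdOrthonormalBasis ℝ V), Finset.smul_sum]
  refine Finset.sum_congr rfl fun r _ => Finset.sum_congr rfl fun j _ => ?_
  simp_rw [inner_smul_left, Finset.prod_mul_distrib]
  simp [smul_smul, mul_assoc]

lemma basis_sum (b : OrthonormalBasis ι ℝ E) {W : Type*} [NormedAddCommGroup W] [InnerProductSpace ℝ W]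
    (L : E →L[ℝ] W) (w : W) (z : E) :
    ∑ i, inner ℝ w (L (b i)) * inner ℝ (b i) z = inner ℝ w (L z) := by
  conv_rhs => rw [← b.sum_repr' z]
  simp only [map_sum, map_smul, inner_sum, inner_smul_right]
  refine Finset.sum_congr rfl fun i _ => mul_comm _ _

/-- Coordinates of a test function, as Schwartz functions. -/
def coordS (v : OrthonormalBasis η ℝ V) (u : X → V) (hu : IsTestFun u) (j : η) : SchwartzMap X ℂ :=
  HasCompactSupport.toSchwartzMap (f := fun x => ((inner ℝ (v j) (u x) : ℝ) : ℂ))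
    (hu.2.comp_left (g := fun z : V => ((inner ℝ (v j) z : ℝ) : ℂ)) (by simp))
    (Complex.ofRealCLM.contDiff.comp (contDiff_const.inner ℝ hu.1))

lemma coordS_deriv (v : OrthonormalBasis η ℝ V) (u : X → V) (hu : IsTestFun u) (j : η) {p : ℕ}
    (w : Fin p → X) (x : X) :
    (∂^{w} (coordS v u hu j)) x = ((inner ℝ (v j) (iteratedFDeriv ℝ p u x w) : ℝ) : ℂ) := by
  rw [SchwartzMap.iteratedLineDerivOp_eq_iteratedFDeriv]
  set L : V →L[ℝ] ℂ := Complex.ofRealCLM.comp (innerSL ℝ (v j)) with hL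
  have h1 : (coordS v u hu j : X → ℂ) = L ∘ u := rfl
  rw [h1, L.iteratedFDeriv_comp_left (n := ∞) hu.1.contDiffAt (by exact_mod_cast le_top)]
  rfl

end Part6

section Part7

set_option linter.unusedSectionVars false

open scoped FourierTransform ContDiff LineDeriv

variable {X : Type*} [NormedAddCommGroup X] [InnerProductSpace ℝ X] [FiniteDimensional ℝ X]
  [MeasurableSpace X] [BorelSpace X]
variable {V E : Type*} [NormedAddCommGroup V] [InnerProductSpace ℝ V] [FiniteDimensional ℝ V]
    [NormedAddCommGroup E] [InnerProductSpace ℝ E] [FiniteDimensional ℝ E]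
variable {κ : Type*} [Fintype κ] [DecidableEq κ] {η : Type*} [Fintype η] [DecidableEq η]
  {ι : Type*} [Fintype ι] [DecidableEq ι]

/-- Coordinates of `A(D)u`, as Schwartz functions. -/
def appS {k : ℕ} (A : DiffOperator X k V E) (e : OrthonormalBasis κ ℝ X) (v : OrthonormalBasis η ℝ V)
    (b : OrthonormalBasis ι ℝ E) (u : X → V) (hu : IsTestFun u) (i : ι) : SchwartzMap X ℂ :=
  ∑ r : Fin k → κ, ∑ j, ((inner ℝ (b i) (A (elemT e r (v j))) : ℝ) : ℂ) •
    ∂^{fun a => e (r a)} (coordS v u hu j)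

lemma appS_apply {k : ℕ} (A : DiffOperator X k V E) (e : OrthonormalBasis κ ℝ X) (v : OrthonormalBasis η ℝ V)
    (b : OrthonormalBasis ι ℝ E) (u : X → V) (hu : IsTestFun u) (i : ι) (y : X) :
    appS A e v b u hu i y = ((inner ℝ (b i) (A.app u y) : ℝ) : ℂ) := by
  unfold appS DiffOperator.app
  rw [expand e v (iteratedFDeriv ℝ k u y)]
  simp only [sum_apply, smul_apply, coordS_deriv, map_sum, map_smul, inner_sum, inner_smul_right,
    smul_eq_mul]
  push_cast
  refine Finset.sum_congr rfl fun r _ => Finset.sum_congr rfl fun j _ => mul_comm _ _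

lemma appS_fourier {k : ℕ} (A : DiffOperator X k V E) (e : OrthonormalBasis κ ℝ X) (v : OrthonormalBasis η ℝ V)
    (b : OrthonormalBasis ι ℝ E) (u : X → V) (hu : IsTestFun u) (i : ι) (ξ : X) :
    𝓕 (appS A e v b u hu i) ξ = (2 * Real.pi * Complex.I) ^ k *
      ∑ j, ((inner ℝ (b i) (A.symbol ξ (v j)) : ℝ) : ℂ) * 𝓕 (coordS v u hu j) ξ := by
  have h0 : 𝓕 (appS A e v b u hu i) = ∑ r : Fin k → κ, ∑ j, ((inner ℝ (b i) (A (elemT e r (v j))) : ℝ) : ℂ) •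
    𝓕 (∂^{fun a => e (r a)} (coordS v u hu j)) := by
    unfold appS
    rw [← SchwartzMap.fourierTransformCLM_apply (𝕜 := ℂ)]
    simp only [map_sum, map_smul]
    rfl
  rw [h0]
  simp only [sum_apply, smul_apply, fourier_iter, smul_eq_mul]
  rw [Finset.sum_comm, Finset.mul_sum]
  refine Finset.sum_congr rfl fun j _ => ?_
  rw [symbol_eq A e v ξ (v j)]
  have h1 : ∀ r : Fin k → κ, ∑ j', ((∏ a, inner ℝ ξ (e (r a))) * inner ℝ (v j') (v j)) • A (elemT e r (v j'))
      = (∏ a, inner ℝ ξ (e (r a))) • A (elemT e r (v j)) := by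
    intro r
    rw [Finset.sum_eq_single j]
    · simp
    · intro j' _ hj
      rw [v.inner_eq_zero hj]; simp
    · simp
  simp only [h1, inner_sum, inner_smul_right]
  push_cast
  rw [Finset.sum_mul, Finset.mul_sum]
  refine Finset.sum_congr rfl fun r _ => by ring

lemma pointwise_one [Nontrivial X] {k ℓ : ℕ} (hℓk : ℓ ≤ k) (A : DiffOperator X k V E) (hA : A.IsElliptic)
    (hAc : A.IsCanceling) {d : ℝ} (hd : 0 < d) (hdl : d + ℓ = Module.finrank ℝ X)
    (e : OrthonormalBasis κ ℝ X) (v : OrthonormalBasis η ℝ V) (b : OrthonormalBasis ι ℝ E)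
    (r : Fin (k - ℓ) → κ) (j : η) :
    ∃ C : ℝ≥0∞, C ≠ ⊤ ∧ ∀ u : X → V, IsTestFun u → ∀ x, x ≠ 0 →
      ‖inner ℝ (v j) (iteratedFDeriv ℝ (k - ℓ) u x fun a => e (r a))‖ₑ
        ≤ C * ∫⁻ y, ENNReal.ofReal (kr d x y) * ‖A.app u y‖ₑ := by
  obtain ⟨P, Q, hPs, hQs, hPS, hQS, hPh, hQh, hQ, hQr⟩ :=
    symbol_pkg A.symbol (symbol_smooth A) (symbol_homog A) hA
  obtain ⟨Ψ, hΨ0, hΨ⟩ := Psi_exists (fun i j ξ => inner ℝ (b i) (Q ξ (b j)))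
    (fun i j ξ hξ => contDiffAt_const.inner ℝ ((hQs ξ hξ).clm_apply contDiffAt_const))
    (fun i j t ξ ht hξ => by rw [hQh t ξ ht hξ])
    (fun c hc => S_inj b A.symbol (symbol_homog A) Q hQs hQ hQr hAc c hc)
  obtain ⟨C, hC0, hC⟩ := representation (ℓ := ℓ) hd hdl
    (fun i ξ => (∏ a, inner ℝ ξ (e (r a))) * inner ℝ (v j) (P ξ (b i)))
    (fun i ξ hξ => by
      refine ContDiffAt.mul ?_ (contDiffAt_const.inner ℝ ((hPs ξ hξ).clm_apply contDiffAt_const))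
      exact contDiffAt_prod fun a _ => contDiffAt_id.inner ℝ contDiffAt_const)
    (fun i t ξ ht hξ => by
      rw [← hPh t ξ ht hξ]
      simp only [inner_smul_left, Finset.prod_mul_distrib, smul_apply, inner_smul_right, conj_trivial,
        Finset.prod_const, Finset.card_univ, Fintype.card_fin]
      have : t ^ k = t ^ ℓ * t ^ (k - ℓ) := by rw [← pow_add]; congr 1; omega
      rw [this]; ring) Ψ hΨ0
  refine ⟨ENNReal.ofReal C * (Fintype.card ι : ℝ≥0∞), ENNReal.mul_ne_top ENNReal.ofReal_ne_top (by simp), ?_⟩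
  intro u hu x hx
  set z : ℂ := 2 * Real.pi * Complex.I with hz
  set g : SchwartzMap X ℂ := ∂^{fun a => e (r a)} (coordS v u hu j) with hg
  have hmain := hC (z ^ ℓ • g) (appS A e v b u hu) ?_ ?_ x hx
  · have h1 : ‖inner ℝ (v j) (iteratedFDeriv ℝ (k - ℓ) u x fun a => e (r a))‖ₑ ≤ ‖(z ^ ℓ • g) x‖ₑ := by
      rw [smul_apply, hg, coordS_deriv, ← ofReal_norm, ← ofReal_norm]
      refine ENNReal.ofReal_le_ofReal ?_
      rw [norm_smul, norm_pow, Complex.norm_real]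
      refine le_mul_of_one_le_left (norm_nonneg _) (one_le_pow₀ ?_)
      rw [hz]
      simp [abs_of_pos Real.pi_pos]
      linarith [Real.pi_gt_three]
    refine h1.trans (hmain.trans ?_)
    rw [mul_assoc]
    gcongr
    rw [← lintegral_const_mul' _ _ (by simp)]
    refine lintegral_mono fun y => ?_
    rw [mul_left_comm]
    gcongr
    refine (Finset.sum_le_card_nsmul _ _ ‖A.app u y‖ₑ fun i _ => ?_).trans (by simp)
    rw [appS_apply, ← ofReal_norm, ← ofReal_norm, Complex.norm_real]
    refine ENNReal.ofReal_le_ofReal ?_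
    refine (norm_inner_le_norm _ _).trans ?_
    simp
  · intro ξ hξ
    have h0 : 𝓕 (z ^ ℓ • g) = z ^ ℓ • 𝓕 g := by
      rw [← SchwartzMap.fourierTransformCLM_apply (𝕜 := ℂ), map_smul]; rfl
    rw [h0, smul_apply, hg, fourier_iter]
    simp only [appS_fourier]
    have h2 : ∀ j', ∑ i, inner ℝ (v j) (P ξ (b i)) * inner ℝ (b i) (A.symbol ξ (v j')) = inner ℝ (v j) (v j') := by
      intro j'
      rw [basis_sum b (P ξ), hPS ξ hξ]
    have h3 : ∑ i, (((∏ a, inner ℝ ξ (e (r a))) * inner ℝ (v j) (P ξ (b i)) : ℝ) : ℂ) * (z ^ k *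
        ∑ j', ((inner ℝ (b i) (A.symbol ξ (v j')) : ℝ) : ℂ) * 𝓕 (coordS v u hu j') ξ)
        = z ^ k * ((∏ a, inner ℝ ξ (e (r a)) : ℝ) : ℂ) * ∑ j', ((inner ℝ (v j) (v j') : ℝ) : ℂ) * 𝓕 (coordS v u hu j') ξ := by
      simp only [← h2, Finset.mul_sum]
      rw [Finset.sum_comm]
      refine Finset.sum_congr rfl fun j' _ => ?_
      rw [Complex.ofReal_sum, Finset.sum_mul, Finset.mul_sum]
      refine Finset.sum_congr rfl fun i _ => ?_
      push_cast; ring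
    rw [h3, Finset.sum_eq_single j]
    · have : z ^ k = z ^ ℓ * z ^ (k - ℓ) := by rw [← pow_add]; congr 1; omega
      rw [this, v.inner_eq_one, smul_eq_mul, Complex.ofReal_one]
      ring
    · intro j' _ hj
      rw [v.inner_eq_zero hj.symm]; simp
    · simp
  · refine hΨ _ fun ξ hξ l => ?_
    simp only [appS_fourier]
    have h2 : ∀ j', ∑ i, inner ℝ (b l) (Q ξ (b i)) * inner ℝ (b i) (A.symbol ξ (v j')) = 0 := by
      intro j'
      rw [basis_sum b (Q ξ), hQS ξ hξ, inner_zero_right]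
    have h3 : ∑ i, ((inner ℝ (b l) (Q ξ (b i)) : ℝ) : ℂ) * (z ^ k *
        ∑ j', ((inner ℝ (b i) (A.symbol ξ (v j')) : ℝ) : ℂ) * 𝓕 (coordS v u hu j') ξ)
        = z ^ k * ∑ j', ((0 : ℝ) : ℂ) * 𝓕 (coordS v u hu j') ξ := by
      simp only [Finset.mul_sum]
      rw [Finset.sum_comm]
      refine Finset.sum_congr rfl fun j' _ => ?_
      rw [← h2 j', Complex.ofReal_sum, Finset.sum_mul, Finset.mul_sum]
      refine Finset.sum_congr rfl fun i _ => ?_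
      push_cast; ring
    rw [h3]; simp

lemma pointwise [Nontrivial X] {k ℓ : ℕ} (hℓk : ℓ ≤ k) (A : DiffOperator X k V E) (hA : A.IsElliptic)
    (hAc : A.IsCanceling) {d : ℝ} (hd : 0 < d) (hdl : d + ℓ = Module.finrank ℝ X) :
    ∃ C : ℝ≥0∞, C ≠ ⊤ ∧ ∀ u : X → V, IsTestFun u → ∀ x, x ≠ 0 →
      ‖iteratedFDeriv ℝ (k - ℓ) u x‖ₑ
        ≤ C * ∫⁻ y, ENNReal.ofReal (kr d x y) * ‖A.app u y‖ₑ := by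
  set e := stdOrthonormalBasis ℝ X
  set v := stdOrthonormalBasis ℝ V
  set b := stdOrthonormalBasis ℝ E
  choose c hc hcb using fun r j => pointwise_one (ℓ := ℓ) hℓk A hA hAc hd hdl e v b r j
  refine ⟨∑ r, ∑ j, ‖elemT (p := k - ℓ) e r (v j)‖ₑ * c r j, ?_, ?_⟩
  · refine ENNReal.sum_ne_top.2 fun r _ => ENNReal.sum_ne_top.2 fun j _ => ?_
    exact ENNReal.mul_ne_top enorm_ne_top (hc r j)
  · intro u hu x hx
    set M := iteratedFDeriv ℝ (k - ℓ) u x with hM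
    have h1 : ‖M‖ₑ ≤ ∑ r : Fin (k - ℓ) → Fin (Module.finrank ℝ X), ∑ j,
        ‖(inner ℝ (v j) (M fun a => e (r a))) • elemT e r (v j)‖ₑ := by
      conv_lhs => rw [expand e v M]
      refine le_trans (enorm_sum_le Finset.univ (fun r : Fin (k - ℓ) → Fin (Module.finrank ℝ X) =>
        ∑ j, (inner ℝ (v j) (M fun a => e (r a))) • elemT e r (v j))) ?_
      exact Finset.sum_le_sum fun r _ => enorm_sum_le Finset.univ
        (fun j => (inner ℝ (v j) (M fun a => e (r a))) • elemT e r (v j))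
    refine h1.trans ?_
    rw [Finset.sum_mul]
    refine Finset.sum_le_sum fun r _ => ?_
    rw [Finset.sum_mul]
    refine Finset.sum_le_sum fun j _ => ?_
    rw [enorm_smul, mul_comm, mul_assoc]
    gcongr
    exact hcb r j u hu x hx

end Part7

/-- Proposition: weighted Hardy–Sobolev estimate for elliptic canceling
operators. If `A(D)` is elliptic and canceling, `ℓ ∈ {1, …, min(k, n−1)}` and
`q ∈ [1, n/(n−ℓ))`, then
`(∫ |D^{k−ℓ}u|^q / |x|^{n−(n−ℓ)q} dx)^{1/q} ≤ C ∫ |A(D)u|` for all `u ∈ C_c^∞(ℝⁿ; V)`. -/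
theorem statement4
    {V E : Type*} [NormedAddCommGroup V] [InnerProductSpace ℝ V] [FiniteDimensional ℝ V]
    [NormedAddCommGroup E] [InnerProductSpace ℝ E] [FiniteDimensional ℝ E]
    {n k ℓ : ℕ} (hn : 2 ≤ n) (hℓ1 : 1 ≤ ℓ) (hℓk : ℓ ≤ k) (hℓn : ℓ ≤ n - 1)
    (A : DiffOperator (EuclideanSpace ℝ (Fin n)) k V E)
    (hA : A.IsElliptic) (hAc : A.IsCanceling)
    (q : ℝ) (hq1 : 1 ≤ q) (hq2 : q < (n : ℝ) / ((n : ℝ) - ℓ)) :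
    ∃ C : ℝ, 0 < C ∧ ∀ u : EuclideanSpace ℝ (Fin n) → V, IsTestFun u →
      (∫⁻ x, (‖iteratedFDeriv ℝ (k - ℓ) u x‖₊ : ℝ≥0∞) ^ q
            / (‖x‖₊ : ℝ≥0∞) ^ ((n : ℝ) - ((n : ℝ) - ℓ) * q)) ^ (1 / q)
        ≤ ENNReal.ofReal C * ∫⁻ x, (‖A.app u x‖₊ : ℝ≥0∞) := by
  have hn0 : (0 : ℝ) < (n : ℝ) - ℓ := by
    have : ℓ < n := by omega
    have : (ℓ : ℝ) < n := by exact_mod_cast this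
    linarith
  have hfin : Module.finrank ℝ (EuclideanSpace ℝ (Fin n)) = n := finrank_euclideanSpace_fin
  have : Nontrivial (EuclideanSpace ℝ (Fin n)) := by
    apply Module.nontrivial_of_finrank_pos (R := ℝ)
    rw [hfin]; omega
  set d : ℝ := (n : ℝ) - ℓ with hd
  have hdq : d * q < (Module.finrank ℝ (EuclideanSpace ℝ (Fin n)) : ℝ) := by
    rw [hfin]
    rw [lt_div_iff₀ hn0] at hq2
    linarith
  obtain ⟨C1, hC1, h1⟩ := schur_bound (X := EuclideanSpace ℝ (Fin n)) hn0 hq1 hdq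
  obtain ⟨C2, hC2, h2⟩ := pointwise hℓk A hA hAc hn0 (by rw [hfin, hd]; ring)
  have hq0 : 0 < q := by linarith
  refine ⟨(C2 * C1).toReal + 1, by positivity, fun u hu => ?_⟩
  have hCle : C2 * C1 ≤ ENNReal.ofReal ((C2 * C1).toReal + 1) := by
    rw [← ENNReal.ofReal_toReal (ENNReal.mul_ne_top hC2 hC1)]
    exact ENNReal.ofReal_le_ofReal (by rw [ENNReal.toReal_ofReal (by positivity)]; linarith)
  have hmeas : Measurable (fun y => ‖A.app u y‖ₑ) := by
    have : Continuous (A.app u) :=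
      A.continuous.comp (hu.1.continuous_iteratedFDeriv (by exact_mod_cast le_top))
    exact this.enorm.measurable
  set F : EuclideanSpace ℝ (Fin n) → ℝ≥0∞ := fun y => ‖A.app u y‖ₑ with hF
  refine le_trans ?_ (mul_le_mul_left hCle _)
  calc (∫⁻ x, (‖iteratedFDeriv ℝ (k - ℓ) u x‖₊ : ℝ≥0∞) ^ q
            / (‖x‖₊ : ℝ≥0∞) ^ ((n : ℝ) - d * q)) ^ (1 / q)
      ≤ (∫⁻ x, C2 ^ q * ((∫⁻ y, ENNReal.ofReal (kr d x y) * F y) ^ q *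
          ENNReal.ofReal (‖x‖ ^ (d * q - Module.finrank ℝ (EuclideanSpace ℝ (Fin n)))))) ^ (1 / q) := by
        gcongr ?_ ^ _
        have hx0 : ∀ᵐ x : EuclideanSpace ℝ (Fin n), x ≠ 0 := by simp [ae_iff]
        refine lintegral_mono_ae ?_
        filter_upwards [hx0] with x hx
        have hxp : 0 < ‖x‖ := norm_pos_iff.2 hx
        have e1 : ENNReal.ofReal (‖x‖ ^ (d * q - Module.finrank ℝ (EuclideanSpace ℝ (Fin n))))
            = ((‖x‖₊ : ℝ≥0∞) ^ ((n : ℝ) - d * q))⁻¹ := by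
          rw [hfin, ← ENNReal.rpow_neg, ← ENNReal.ofReal_rpow_of_pos hxp, neg_sub]
          congr 1
          exact ofReal_norm x
        rw [e1, ← mul_assoc, ← ENNReal.mul_rpow_of_nonneg _ _ hq0.le, div_eq_mul_inv]
        gcongr
        exact h2 u hu x hx
    _ = C2 * (∫⁻ x, ((∫⁻ y, ENNReal.ofReal (kr d x y) * F y) ^ q *
          ENNReal.ofReal (‖x‖ ^ (d * q - Module.finrank ℝ (EuclideanSpace ℝ (Fin n)))))) ^ (1 / q) := by
        rw [lintegral_const_mul' _ _ (ENNReal.rpow_ne_top_of_nonneg hq0.le hC2),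
          ENNReal.mul_rpow_of_nonneg _ _ (by positivity), ← ENNReal.rpow_mul, mul_one_div_cancel hq0.ne',
          ENNReal.rpow_one]
    _ ≤ C2 * (C1 * ∫⁻ y, F y) := by
        gcongr
        exact h1 F hmeas
    _ = _ := by rw [mul_assoc]; rfl
end
end

section
/- Let A(D) be a homogeneous linear differential operator of order k on ℝⁿ from V to E. If A(D) is elliptic and canceling, then there exist a constant C > 0 and a positive integer m such that for every u ∈ C_c^∞(ℝⁿ; V) and every φ ∈ C_c^∞(ℝⁿ; E), |∫_{ℝⁿ} φ(x) · A(D)u(x) dx| ≤ C ∑_{j=1}^{m} ∫_{ℝⁿ} |A(D)u(x)| · |x|^j · |D^j φ(x)| dx. -/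
open MeasureTheory ENNReal
open scoped NNReal RealInnerProductSpace

noncomputable section

open MvPolynomial in
theorem exists_poly_action {n : ℕ} {M : Type*} [AddCommGroup M] [Module ℝ M]
    (d : Fin n → Module.End ℝ M) (hd : ∀ i j, d i * d j = d j * d i) :
    ∃ Φ : MvPolynomial (Fin n) ℝ →ₐ[ℝ] Module.End ℝ M, ∀ i, Φ (X i) = d i := by
  have hc : ∀ a ∈ Set.range d, ∀ b ∈ Set.range d, a * b = b * a := by
    rintro _ ⟨i, rfl⟩ _ ⟨j, rfl⟩
    exact hd i j
  letI : CommRing (Algebra.adjoin ℝ (Set.range d)) := Algebra.adjoinCommRingOfComm ℝ hc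
  let d' : Fin n → Algebra.adjoin ℝ (Set.range d) :=
    fun i => ⟨d i, Algebra.subset_adjoin ⟨i, rfl⟩⟩
  refine ⟨(Algebra.adjoin ℝ (Set.range d)).val.comp (aeval d'), fun i => ?_⟩
  simp [d']

/-- scalar test functions -/
def TF (n : ℕ) : Submodule ℝ (EuclideanSpace ℝ (Fin n) → ℝ) where
  carrier := {f | IsTestFun f}
  add_mem' := fun {a b} ha hb => ⟨ha.1.add hb.1, ha.2.add hb.2⟩
  zero_mem' := ⟨contDiff_const, HasCompactSupport.zero⟩
  smul_mem' := fun c f hf => ⟨contDiff_const.smul hf.1, hf.2.smul_left (f := fun _ => c)⟩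

theorem TF.smooth {n : ℕ} (f : TF n) : ContDiff ℝ (⊤ : ℕ∞) (f : EuclideanSpace ℝ (Fin n) → ℝ) :=
  f.2.1
theorem TF.cs {n : ℕ} (f : TF n) : HasCompactSupport (f : EuclideanSpace ℝ (Fin n) → ℝ) :=
  f.2.2
theorem TF.diff {n : ℕ} (f : TF n) : Differentiable ℝ (f : EuclideanSpace ℝ (Fin n) → ℝ) :=
  f.2.1.differentiable (by simp)

abbrev eb {n : ℕ} (i : Fin n) : EuclideanSpace ℝ (Fin n) := EuclideanSpace.single i 1

theorem pd_test {n : ℕ} (i : Fin n) (f : TF n) :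
    IsTestFun (fun x => fderiv ℝ f.1 x (eb i)) :=
  ⟨((TF.smooth f).fderiv_right (m := (⊤ : ℕ∞)) (by simp)).clm_apply contDiff_const,
    ((TF.cs f).fderiv ℝ).comp_left
      (g := fun L : EuclideanSpace ℝ (Fin n) →L[ℝ] ℝ => L (eb i)) rfl⟩

/-- partial derivative -/
def pd {n : ℕ} (i : Fin n) : Module.End ℝ (TF n) where
  toFun f := ⟨fun x => fderiv ℝ f.1 x (eb i), pd_test i f⟩
  map_add' f g := by
    ext x
    change fderiv ℝ ((f : EuclideanSpace ℝ (Fin n) → ℝ) + (g : EuclideanSpace ℝ (Fin n) → ℝ)) x (eb i) = _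
    rw [fderiv_add ((TF.diff f) x) ((TF.diff g) x)]
    rfl
  map_smul' c f := by
    ext x
    change fderiv ℝ (c • (f : EuclideanSpace ℝ (Fin n) → ℝ)) x (eb i) = _
    rw [fderiv_const_smul ((TF.diff f) x) c]
    rfl

theorem pd_apply {n : ℕ} (i : Fin n) (f : TF n) (x : EuclideanSpace ℝ (Fin n)) :
    (pd i f).1 x = fderiv ℝ f.1 x (eb i) := rfl

theorem pd_comm {n : ℕ} (i j : Fin n) : pd i * pd j = pd j * pd i := by
  have key : ∀ (i j : Fin n) (f : TF n) (x : EuclideanSpace ℝ (Fin n)),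
      (pd i (pd j f)).1 x = fderiv ℝ (fderiv ℝ f.1) x (eb i) (eb j) := by
    intro i j f x
    rw [pd_apply]
    change fderiv ℝ (fun y => fderiv ℝ f.1 y (eb j)) x (eb i) = _
    have hd : DifferentiableAt ℝ (fderiv ℝ f.1) x :=
      (((TF.smooth f).fderiv_right (m := (⊤ : ℕ∞)) (by simp)).differentiable (by simp)) x
    rw [fderiv_clm_apply hd (differentiableAt_const _)]
    simp
  apply LinearMap.ext
  intro f
  ext x
  have hs : IsSymmSndFDerivAt ℝ f.1 x := (TF.smooth f).contDiffAt.isSymmSndFDerivAt (by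
    rw [minSmoothness_of_isRCLikeNormedField]; exact WithTop.coe_le_coe.2 (le_top (a := (2 : ℕ∞))))
  exact (key i j f x).trans ((hs _ _).trans (key j i f x).symm)

/-- the action of polynomials -/
def PD (n : ℕ) : MvPolynomial (Fin n) ℝ →ₐ[ℝ] Module.End ℝ (TF n) :=
  (exists_poly_action (pd (n := n)) pd_comm).choose

theorem PD_X {n : ℕ} (i : Fin n) : PD n (MvPolynomial.X i) = pd i :=
  (exists_poly_action (pd (n := n)) pd_comm).choose_spec i

theorem PD_mul {n : ℕ} (p q : MvPolynomial (Fin n) ℝ) (f : TF n) :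
    PD n (p * q) f = PD n p (PD n q f) := by
  rw [map_mul]; rfl

theorem TF.integrable_mul {n : ℕ} (f g : TF n) : Integrable (fun x => f.1 x * g.1 x) :=
  ((TF.smooth f).continuous.mul (TF.smooth g).continuous).integrable_of_hasCompactSupport ((TF.cs f).mul_right)

theorem pd_parts {n : ℕ} (i : Fin n) (f g : TF n) :
    ∫ x, (pd i f).1 x * g.1 x = - ∫ x, f.1 x * (pd i g).1 x := by
  have := integral_mul_fderiv_eq_neg_fderiv_mul_of_integrable (μ := volume) (v := eb i)
    (f := f.1) (g := g.1) (TF.integrable_mul (pd i f) g) (TF.integrable_mul f (pd i g))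
    (TF.integrable_mul f g) (fun x _ => TF.diff f x) (fun x _ => TF.diff g x)
  simp only [pd_apply]
  rw [this, neg_neg]

theorem exists_monomial_step {n r : ℕ} (d : Fin n →₀ ℕ) (hd : d.degree = r + 1) :
    ∃ i d', d'.degree = r ∧ d = d' + Finsupp.single i 1 := by
  have : d ≠ 0 := by rintro rfl; simp at hd
  obtain ⟨i, hi⟩ := Finsupp.ne_iff.1 this
  have hle : Finsupp.single i 1 ≤ d := by
    rw [Finsupp.single_le_iff]; exact Nat.one_le_iff_ne_zero.2 hi
  refine ⟨i, d - Finsupp.single i 1, ?_, (tsub_add_cancel_of_le hle).symm⟩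
  have h2 := congrArg Finsupp.degree (tsub_add_cancel_of_le hle)
  rw [map_add, hd] at h2
  simpa using h2

theorem PD_step {n : ℕ} (d : Fin n →₀ ℕ) (i : Fin n) (f : TF n) :
    PD n (MvPolynomial.monomial (d + Finsupp.single i 1) 1) f =
      PD n (MvPolynomial.monomial d 1) (pd i f) := by
  rw [← PD_X, ← PD_mul, MvPolynomial.X, MvPolynomial.monomial_mul, one_mul]

theorem PD_zero' {n : ℕ} (f : TF n) : PD n (MvPolynomial.monomial 0 1) f = f := by
  have : (MvPolynomial.monomial 0 1 : MvPolynomial (Fin n) ℝ) = 1 := rfl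
  rw [this, map_one]; rfl

theorem PD_expand {n : ℕ} (p : MvPolynomial (Fin n) ℝ) (f : TF n) (x) :
    (PD n p f).1 x =
      ∑ d ∈ p.support, p.coeff d * (PD n (MvPolynomial.monomial d 1) f).1 x := by
  conv_lhs => rw [p.as_sum]
  have h : ∀ d, MvPolynomial.monomial d (p.coeff d) =
      p.coeff d • (MvPolynomial.monomial d 1 : MvPolynomial (Fin n) ℝ) := by
    intro d; rw [MvPolynomial.smul_monomial, smul_eq_mul, mul_one]
  simp only [h, map_sum, map_smul, LinearMap.sum_apply, LinearMap.smul_apply]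
  simp [Submodule.coe_sum, Finset.sum_apply]

theorem mono_parts {n : ℕ} : ∀ (r : ℕ) (d : Fin n →₀ ℕ), d.degree = r → ∀ f g : TF n,
    ∫ x, (PD n (MvPolynomial.monomial d 1) f).1 x * g.1 x =
      (-1) ^ r * ∫ x, f.1 x * (PD n (MvPolynomial.monomial d 1) g).1 x := by
  intro r
  induction r with
  | zero =>
    intro d hd f g
    obtain rfl : d = 0 := (Finsupp.degree_eq_zero_iff d).1 hd
    simp [PD_zero']
  | succ r ih =>
    intro d hd f g
    obtain ⟨i, d', hd', rfl⟩ := exists_monomial_step d hd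
    rw [PD_step, ih d' hd', pd_parts, add_comm d', ← one_mul (1 : ℝ),
      ← MvPolynomial.monomial_mul, PD_mul]
    change _ = _ * ∫ x, f.1 x * (PD n (MvPolynomial.X i) _).1 x
    rw [PD_X, one_mul]
    ring

theorem hom_parts {n r : ℕ} (p : MvPolynomial (Fin n) ℝ) (hp : p.IsHomogeneous r) (f g : TF n) :
    ∫ x, (PD n p f).1 x * g.1 x = (-1) ^ r * ∫ x, f.1 x * (PD n p g).1 x := by
  simp only [PD_expand p, Finset.sum_mul, Finset.mul_sum]
  rw [integral_finsetSum, integral_finsetSum, Finset.mul_sum]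
  · refine Finset.sum_congr rfl fun d hd => ?_
    have hdeg : d.degree = r := by
      have := hp (MvPolynomial.mem_support_iff.1 hd)
      rwa [Finsupp.degree_eq_weight_one]
    simp only [mul_assoc, mul_left_comm _ (p.coeff d)]
    rw [integral_const_mul, integral_const_mul, mono_parts r d hdeg]
    ring
  · intro d _
    simp only [mul_left_comm _ (p.coeff d)]
    exact (TF.integrable_mul _ _).const_mul _
  · intro d _
    simp only [mul_assoc]
    exact (TF.integrable_mul _ _).const_mul _

/-- multiplication by a power of a linear form -/
def mulT {n : ℕ} (ξ : EuclideanSpace ℝ (Fin n)) (l : ℕ) (f : TF n) : TF n :=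
  ⟨fun x => ⟪ξ, x⟫ ^ l * f.1 x,
    ((contDiff_const.inner ℝ contDiff_id).pow l).mul (TF.smooth f), (TF.cs f).mul_left⟩

theorem mt_apply {n : ℕ} (ξ : EuclideanSpace ℝ (Fin n)) (l : ℕ) (f : TF n) (x) :
    (mulT ξ l f).1 x = ⟪ξ, x⟫ ^ l * f.1 x := rfl

theorem pd_mt {n : ℕ} (ξ : EuclideanSpace ℝ (Fin n)) (l : ℕ) (i : Fin n) (f : TF n) :
    pd i (mulT ξ (l + 1) f) = ((l + 1 : ℝ) * ξ i) • mulT ξ l f + mulT ξ (l + 1) (pd i f) := by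
  ext x
  change fderiv ℝ (fun x => ⟪ξ, x⟫ ^ (l + 1) * f.1 x) x (eb i) =
    ((l + 1 : ℝ) * ξ i) * (⟪ξ, x⟫ ^ l * f.1 x) + ⟪ξ, x⟫ ^ (l + 1) * fderiv ℝ f.1 x (eb i)
  have h1 : HasFDerivAt (fun x : EuclideanSpace ℝ (Fin n) => ⟪ξ, x⟫) (innerSL ℝ ξ) x :=
    (innerSL ℝ ξ).hasFDerivAt
  have h2 := (h1.pow (l + 1)).mul ((TF.diff f) x).hasFDerivAt
  have h3 : fderiv ℝ (fun x => ⟪ξ, x⟫ ^ (l + 1) * f.1 x) x = _ := h2.fderiv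
  rw [h3]
  simp [eb, EuclideanSpace.inner_single_right]
  ring

theorem norm_pd_le {n : ℕ} (i : Fin n) (f : TF n) (j : ℕ) (x) :
    ‖iteratedFDeriv ℝ j (pd i f).1 x‖ ≤ ‖iteratedFDeriv ℝ (j + 1) f.1 x‖ := by
  have h := norm_iteratedFDeriv_clm_apply_const (𝕜 := ℝ) (f := fderiv ℝ f.1) (c := eb i) (x := x)
    (N := ((⊤ : ℕ∞) : WithTop ℕ∞)) (n := j)
    ((TF.smooth f).fderiv_right (m := (⊤ : ℕ∞)) (by simp)).contDiffAt (by exact mod_cast le_top)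
  rw [norm_iteratedFDeriv_fderiv] at h
  simp only [eb, EuclideanSpace.norm_single, norm_one, one_mul] at h
  exact h

theorem mono_bound {n : ℕ} (ξ : EuclideanSpace ℝ (Fin n)) :
    ∀ (r : ℕ) (d : Fin n →₀ ℕ), d.degree = r → ∀ q : ℕ, ∃ C : ℝ, 0 ≤ C ∧ ∀ (f : TF n) (x),
      |(PD n (MvPolynomial.monomial d 1) (mulT ξ (r + q) f)).1 x| ≤
        C * ∑ j ∈ Finset.range (r + 1), ‖x‖ ^ (q + j) * ‖iteratedFDeriv ℝ j f.1 x‖ := by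
  intro r
  induction r with
  | zero =>
    intro d hd q
    obtain rfl : d = 0 := (Finsupp.degree_eq_zero_iff d).1 hd
    refine ⟨‖ξ‖ ^ q, by positivity, fun f x => ?_⟩
    rw [PD_zero', mt_apply]
    simp only [zero_add, Finset.range_one, Finset.sum_singleton, add_zero,
      norm_iteratedFDeriv_zero, abs_mul, abs_pow, ← mul_assoc, ← mul_pow, Real.norm_eq_abs]
    gcongr
    exact abs_real_inner_le_norm _ _
  | succ r ih =>
    intro d hd q
    obtain ⟨i, d', hd', rfl⟩ := exists_monomial_step d hd
    obtain ⟨C1, hC1, h1⟩ := ih d' hd' q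
    obtain ⟨C2, hC2, h2⟩ := ih d' hd' (q + 1)
    refine ⟨|((r + q : ℕ) + 1 : ℝ)| * |ξ i| * C1 + C2, by positivity, fun f x => ?_⟩
    rw [PD_step, show r + 1 + q = (r + q) + 1 by ring, pd_mt, map_add, map_smul]
    have e1 := h1 f x
    have e2 := h2 (pd i f) x
    rw [← add_assoc r q 1] at e2
    set a := PD n (MvPolynomial.monomial d' 1) (mulT ξ (r + q) f)
    set b := PD n (MvPolynomial.monomial d' 1) (mulT ξ (r + q + 1) (pd i f))
    change |(((r + q : ℕ) + 1 : ℝ) * ξ i) * a.1 x + b.1 x| ≤ _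
    have s1 : ∑ j ∈ Finset.range (r + 1), ‖x‖ ^ (q + j) * ‖iteratedFDeriv ℝ j f.1 x‖ ≤
        ∑ j ∈ Finset.range (r + 1 + 1), ‖x‖ ^ (q + j) * ‖iteratedFDeriv ℝ j f.1 x‖ := by
      rw [Finset.sum_range_succ _ (r + 1)]
      have : 0 ≤ ‖x‖ ^ (q + (r + 1)) * ‖iteratedFDeriv ℝ (r + 1) f.1 x‖ := by positivity
      linarith
    have s2 : ∑ j ∈ Finset.range (r + 1), ‖x‖ ^ (q + 1 + j) * ‖iteratedFDeriv ℝ j (pd i f).1 x‖ ≤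
        ∑ j ∈ Finset.range (r + 1 + 1), ‖x‖ ^ (q + j) * ‖iteratedFDeriv ℝ j f.1 x‖ := by
      rw [Finset.sum_range_succ' _ (r + 1)]
      have h0 : 0 ≤ ‖x‖ ^ (q + 0) * ‖iteratedFDeriv ℝ 0 f.1 x‖ := by positivity
      have : ∑ j ∈ Finset.range (r + 1), ‖x‖ ^ (q + 1 + j) * ‖iteratedFDeriv ℝ j (pd i f).1 x‖ ≤
          ∑ j ∈ Finset.range (r + 1), ‖x‖ ^ (q + (j + 1)) * ‖iteratedFDeriv ℝ (j + 1) f.1 x‖ := by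
        refine Finset.sum_le_sum fun j _ => ?_
        rw [show q + 1 + j = q + (j + 1) by ring]
        gcongr
        exact norm_pd_le i f j x
      linarith
    calc _ ≤ |((r + q : ℕ) + 1 : ℝ)| * |ξ i| * |a.1 x| + |b.1 x| := by
          rw [← abs_mul, ← abs_mul]; exact abs_add_le _ _
      _ ≤ |((r + q : ℕ) + 1 : ℝ)| * |ξ i| * (C1 * _) + C2 * _ := by
          exact add_le_add (mul_le_mul_of_nonneg_left
            (e1.trans (mul_le_mul_of_nonneg_left s1 hC1)) (by positivity))
            (e2.trans (mul_le_mul_of_nonneg_left s2 hC2))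
      _ = _ := by ring

theorem mono_main {n : ℕ} (ξ : EuclideanSpace ℝ (Fin n)) :
    ∀ (r : ℕ) (d : Fin n →₀ ℕ), d.degree = r → ∃ C : ℝ, 0 ≤ C ∧ ∀ (f : TF n) (x),
      |(PD n (MvPolynomial.monomial d 1) (mulT ξ r f)).1 x -
        r.factorial * MvPolynomial.eval ξ (MvPolynomial.monomial d 1) * f.1 x| ≤
        C * ∑ j ∈ Finset.range r, ‖x‖ ^ (j + 1) * ‖iteratedFDeriv ℝ (j + 1) f.1 x‖ := by
  intro r
  induction r with
  | zero =>
    intro d hd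
    obtain rfl : d = 0 := (Finsupp.degree_eq_zero_iff d).1 hd
    refine ⟨0, le_rfl, fun f x => ?_⟩
    rw [PD_zero', mt_apply]
    simp
  | succ r ih =>
    intro d hd
    obtain ⟨i, d', hd', rfl⟩ := exists_monomial_step d hd
    obtain ⟨C1, hC1, h1⟩ := ih d' hd'
    obtain ⟨C2, hC2, h2⟩ := mono_bound ξ r d' hd' 1
    refine ⟨|(r : ℝ) + 1| * |ξ i| * C1 + C2, by positivity, fun f x => ?_⟩
    rw [PD_step, pd_mt, map_add, map_smul]
    have e1 := h1 f x
    have e2 := h2 (pd i f) x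
    have hev : MvPolynomial.eval ξ (MvPolynomial.monomial (d' + Finsupp.single i 1) (1 : ℝ)) =
        MvPolynomial.eval ξ (MvPolynomial.monomial d' (1 : ℝ)) * ξ i := by
      rw [← one_mul (1 : ℝ), ← MvPolynomial.monomial_mul, map_mul, one_mul]
      congr 1
      exact MvPolynomial.eval_X i
    rw [hev, Nat.factorial_succ]
    set a := PD n (MvPolynomial.monomial d' 1) (mulT ξ r f)
    set b := PD n (MvPolynomial.monomial d' 1) (mulT ξ (r + 1) (pd i f))
    set v := MvPolynomial.eval ξ (MvPolynomial.monomial d' (1 : ℝ))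
    change |((r + 1 : ℝ) * ξ i) * a.1 x + b.1 x - _| ≤ _
    have s1 : ∑ j ∈ Finset.range r, ‖x‖ ^ (j + 1) * ‖iteratedFDeriv ℝ (j + 1) f.1 x‖ ≤
        ∑ j ∈ Finset.range (r + 1), ‖x‖ ^ (j + 1) * ‖iteratedFDeriv ℝ (j + 1) f.1 x‖ := by
      rw [Finset.sum_range_succ _ r]
      have : 0 ≤ ‖x‖ ^ (r + 1) * ‖iteratedFDeriv ℝ (r + 1) f.1 x‖ := by positivity
      linarith
    have s2 : ∑ j ∈ Finset.range (r + 1), ‖x‖ ^ (1 + j) * ‖iteratedFDeriv ℝ j (pd i f).1 x‖ ≤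
        ∑ j ∈ Finset.range (r + 1), ‖x‖ ^ (j + 1) * ‖iteratedFDeriv ℝ (j + 1) f.1 x‖ := by
      refine Finset.sum_le_sum fun j _ => ?_
      rw [show 1 + j = j + 1 by ring]
      gcongr
      exact norm_pd_le i f j x
    calc _ = |((r + 1 : ℝ) * ξ i) * (a.1 x - r.factorial * v * f.1 x) + b.1 x| := by
          push_cast; congr 1; ring
      _ ≤ |(r + 1 : ℝ)| * |ξ i| * |a.1 x - r.factorial * v * f.1 x| + |b.1 x| := by
          rw [← abs_mul, ← abs_mul]; exact abs_add_le _ _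
      _ ≤ |(r + 1 : ℝ)| * |ξ i| * (C1 * _) + C2 * _ := by
          exact add_le_add (mul_le_mul_of_nonneg_left
            (e1.trans (mul_le_mul_of_nonneg_left s1 hC1)) (by positivity))
            (e2.trans (mul_le_mul_of_nonneg_left s2 hC2))
      _ = _ := by ring

theorem hom_main {n r : ℕ} (ξ : EuclideanSpace ℝ (Fin n)) (p : MvPolynomial (Fin n) ℝ)
    (hp : p.IsHomogeneous r) : ∃ C : ℝ, 0 ≤ C ∧ ∀ (f : TF n) (x),
      |(PD n p (mulT ξ r f)).1 x - r.factorial * MvPolynomial.eval ξ p * f.1 x| ≤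
        C * ∑ j ∈ Finset.range r, ‖x‖ ^ (j + 1) * ‖iteratedFDeriv ℝ (j + 1) f.1 x‖ := by
  have h : ∀ d : Fin n →₀ ℕ, ∃ C : ℝ, d ∈ p.support → 0 ≤ C ∧ ∀ (f : TF n) (x),
      |(PD n (MvPolynomial.monomial d 1) (mulT ξ r f)).1 x -
        r.factorial * MvPolynomial.eval ξ (MvPolynomial.monomial d 1) * f.1 x| ≤
        C * ∑ j ∈ Finset.range r, ‖x‖ ^ (j + 1) * ‖iteratedFDeriv ℝ (j + 1) f.1 x‖ := by
    intro d
    by_cases hd : d ∈ p.support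
    · have hdeg : d.degree = r := by
        have := hp (MvPolynomial.mem_support_iff.1 hd)
        rwa [Finsupp.degree_eq_weight_one]
      obtain ⟨C, hC⟩ := mono_main ξ r d hdeg
      exact ⟨C, fun _ => hC⟩
    · exact ⟨0, fun h => absurd h hd⟩
  choose C hC using h
  refine ⟨∑ d ∈ p.support, |p.coeff d| * C d,
    Finset.sum_nonneg fun d hd => mul_nonneg (abs_nonneg _) (hC d hd).1, fun f x => ?_⟩
  have hev : MvPolynomial.eval ξ p = ∑ d ∈ p.support,
      p.coeff d * MvPolynomial.eval ξ (MvPolynomial.monomial d (1 : ℝ)) := by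
    conv_lhs => rw [p.as_sum]
    rw [map_sum]
    refine Finset.sum_congr rfl fun d _ => ?_
    simp [MvPolynomial.eval_monomial]
  rw [PD_expand, hev, Finset.mul_sum, Finset.sum_mul, ← Finset.sum_sub_distrib, Finset.sum_mul]
  refine (Finset.abs_sum_le_sum_abs _ _).trans (Finset.sum_le_sum fun d hd => ?_)
  have e := mul_le_mul_of_nonneg_left ((hC d hd).2 f x) (abs_nonneg (p.coeff d))
  rw [← abs_mul] at e
  calc _ = _ := by congr 1; ring
    _ ≤ _ := e
    _ = _ := by ring

open Matrix in
/-- the compatibility operator -/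
def compatMat {n : ℕ} {ι κ : Type} [Fintype ι] [DecidableEq ι] [Fintype κ] [DecidableEq κ]
    (P : Matrix ι κ (MvPolynomial (Fin n) ℝ)) : Matrix ι ι (MvPolynomial (Fin n) ℝ) :=
  (Pᵀ * P).det • (1 : Matrix ι ι (MvPolynomial (Fin n) ℝ)) - P * (Pᵀ * P).adjugate * Pᵀ

theorem compatMat_mul {n : ℕ} {ι κ : Type} [Fintype ι] [DecidableEq ι] [Fintype κ] [DecidableEq κ]
    (P : Matrix ι κ (MvPolynomial (Fin n) ℝ)) : compatMat P * P = 0 := by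
  rw [compatMat, Matrix.sub_mul, Matrix.mul_assoc, Matrix.mul_assoc, Matrix.adjugate_mul]
  simp

theorem det_homog {n : ℕ} {κ : Type} [Fintype κ] [DecidableEq κ]
    (M : Matrix κ κ (MvPolynomial (Fin n) ℝ)) (r : κ → ℕ)
    (h : ∀ i j, (M i j).IsHomogeneous (r i)) : M.det.IsHomogeneous (∑ i, r i) := by
  rw [← Matrix.det_transpose, Matrix.det_apply]
  refine MvPolynomial.IsHomogeneous.sum _ _ _ fun σ _ => ?_
  have : (∏ i, M.transpose (σ i) i).IsHomogeneous (∑ i, r i) :=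
    MvPolynomial.IsHomogeneous.prod _ _ _ fun i _ => h i (σ i)
  rcases Int.units_eq_one_or (Equiv.Perm.sign σ) with hs | hs
  · simpa [hs] using this
  · simpa [hs] using this.neg

theorem mul_homog {n : ℕ} {ι κ μ : Type} [Fintype κ] {a b : ℕ}
    (M : Matrix ι κ (MvPolynomial (Fin n) ℝ)) (N : Matrix κ μ (MvPolynomial (Fin n) ℝ))
    (hM : ∀ i j, (M i j).IsHomogeneous a) (hN : ∀ i j, (N i j).IsHomogeneous b) (i : ι) (j : μ) :
    ((M * N) i j).IsHomogeneous (a + b) := by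
  rw [Matrix.mul_apply]
  exact MvPolynomial.IsHomogeneous.sum _ _ _ fun l _ => (hM i l).mul (hN l j)

theorem compatMat_homog {n k : ℕ} {ι κ : Type} [Fintype ι] [DecidableEq ι] [Fintype κ]
    [DecidableEq κ] (P : Matrix ι κ (MvPolynomial (Fin n) ℝ))
    (hP : ∀ i j, (P i j).IsHomogeneous k) (i j : ι) :
    (compatMat P i j).IsHomogeneous (Fintype.card κ * (k + k)) := by
  have hT : ∀ i j, (P.transpose i j).IsHomogeneous k := fun i j => hP j i
  have hB := mul_homog _ _ hT hP
  have hdet : (P.transpose * P).det.IsHomogeneous (Fintype.card κ * (k + k)) := by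
    have := det_homog _ (fun _ => k + k) hB
    simpa using this
  have hadj : ∀ a b, ((P.transpose * P).adjugate a b).IsHomogeneous
      ((Fintype.card κ - 1) * (k + k)) := by
    intro a b
    rw [Matrix.adjugate_apply]
    have := det_homog ((P.transpose * P).updateRow b (Pi.single a 1))
      (fun i => if i = b then 0 else k + k) (by
        intro i j
        by_cases hi : i = b
        · subst hi
          simp only [Matrix.updateRow_self, if_true]
          by_cases hj : j = a
          · subst hj; simpa using MvPolynomial.isHomogeneous_one _ _
          · simpa [hj] using MvPolynomial.isHomogeneous_zero _ _ _
        · simpa [hi, Matrix.updateRow_ne hi] using hB i j)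
    convert this using 1
    rw [Finset.sum_ite]
    simp [Finset.filter_ne', Finset.card_erase_of_mem]
  rw [compatMat, Matrix.sub_apply]
  refine MvPolynomial.IsHomogeneous.sub ?_ ?_
  · rw [Matrix.smul_apply, smul_eq_mul]
    by_cases hij : i = j
    · subst hij; simpa using hdet
    · simpa [hij] using MvPolynomial.isHomogeneous_zero _ _ _
  · rcases isEmpty_or_nonempty κ with hκ | hκ
    · rw [Matrix.mul_apply]
      simpa using MvPolynomial.isHomogeneous_zero _ _ _
    · have := mul_homog _ _ (mul_homog _ _ hP hadj) hT i j
      have h1 : 0 < Fintype.card κ := Fintype.card_pos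
      obtain ⟨c, hc⟩ : ∃ c, Fintype.card κ = c + 1 := ⟨Fintype.card κ - 1, by omega⟩
      have h2 : k + (Fintype.card κ - 1) * (k + k) + k = Fintype.card κ * (k + k) := by
        rw [hc, Nat.add_sub_cancel]; ring
      rw [← h2]; exact this

theorem compatMat_range {n : ℕ} {ι κ : Type} [Fintype ι] [DecidableEq ι] [Fintype κ]
    [DecidableEq κ] (P : Matrix ι κ (MvPolynomial (Fin n) ℝ)) (ξ : Fin n → ℝ)
    (hinj : ∀ v, (P.map (MvPolynomial.eval ξ)).mulVec v = 0 → v = 0) (e : ι → ℝ)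
    (he : ∀ j, ∑ i, MvPolynomial.eval ξ (compatMat P j i) * e i = 0) :
    ∃ v, (P.map (MvPolynomial.eval ξ)).mulVec v = e := by
  set Q := P.map (MvPolynomial.eval ξ) with hQ
  have hL : (compatMat P).map (MvPolynomial.eval ξ) =
      (Q.transpose * Q).det • (1 : Matrix ι ι ℝ) - Q * (Q.transpose * Q).adjugate * Q.transpose := by
    have hB : (P.transpose * P).map (MvPolynomial.eval ξ) = Q.transpose * Q := by
      rw [Matrix.map_mul, hQ, Matrix.transpose_map]
    have hd : MvPolynomial.eval ξ (P.transpose * P).det = (Q.transpose * Q).det := by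
      rw [RingHom.map_det, RingHom.mapMatrix_apply, hB]
    have ha : (P.transpose * P).adjugate.map (MvPolynomial.eval ξ) =
        (Q.transpose * Q).adjugate := by
      rw [← hB, ← RingHom.mapMatrix_apply, ← RingHom.mapMatrix_apply, RingHom.map_adjugate]
    have h2 : (P * (P.transpose * P).adjugate * P.transpose).map (MvPolynomial.eval ξ) =
        Q * (Q.transpose * Q).adjugate * Q.transpose := by
      rw [Matrix.map_mul, Matrix.map_mul, ha, hQ, Matrix.transpose_map]
    rw [← h2, ← hd]
    ext a b
    simp only [compatMat, Matrix.map_apply, Matrix.sub_apply, Matrix.smul_apply, smul_eq_mul,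
      map_sub, map_mul]
    congr 2
    by_cases hab : a = b
    · subst hab; simp
    · simp [hab]
  have hdet : (Q.transpose * Q).det ≠ 0 := by
    intro h0
    obtain ⟨v, hv, hv0⟩ := Matrix.exists_mulVec_eq_zero_iff.2 h0
    apply hv
    apply hinj
    have := (Matrix.conjTranspose_mul_self_mulVec_eq_zero Q v).1
    rw [Matrix.conjTranspose_eq_transpose_of_trivial] at this
    exact this hv0
  have he' : ((compatMat P).map (MvPolynomial.eval ξ)).mulVec e = 0 := by
    ext j
    exact he j
  rw [hL, Matrix.sub_mulVec, Matrix.smul_mulVec, Matrix.one_mulVec, sub_eq_zero] at he'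
  refine ⟨(Q.transpose * Q).det⁻¹ • ((Q.transpose * Q).adjugate * Q.transpose).mulVec e, ?_⟩
  rw [Matrix.mulVec_smul, Matrix.mulVec_mulVec, ← Matrix.mul_assoc, ← he', smul_smul,
    inv_mul_cancel₀ hdet, one_smul]

/-- elementary tensor -/
def tens {n k : ℕ} {V : Type*} [NormedAddCommGroup V] [NormedSpace ℝ V]
    (w : Fin k → Fin n) (v : V) :
    ContinuousMultilinearMap ℝ (fun _ : Fin k => EuclideanSpace ℝ (Fin n)) V :=
  (ContinuousMultilinearMap.piFieldEquiv ℝ (Fin k) V v).compContinuousLinearMap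
    (fun s => EuclideanSpace.proj (w s))

theorem tens_apply {n k : ℕ} {V : Type*} [NormedAddCommGroup V] [NormedSpace ℝ V]
    (w : Fin k → Fin n) (v : V) (y : Fin k → EuclideanSpace ℝ (Fin n)) :
    tens w v y = (∏ s, y s (w s)) • v := by
  simp [tens, ContinuousMultilinearMap.piFieldEquiv]

theorem tens_expand {n k : ℕ} {V : Type*} [NormedAddCommGroup V] [NormedSpace ℝ V]
    (M : ContinuousMultilinearMap ℝ (fun _ : Fin k => EuclideanSpace ℝ (Fin n)) V) :
    M = ∑ w : Fin k → Fin n, tens w (M fun s => eb (w s)) := by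
  apply ContinuousMultilinearMap.toMultilinearMap_injective
  refine Module.Basis.ext_multilinear (fun _ => (EuclideanSpace.basisFun (Fin n) ℝ).toBasis) ?_
  intro w
  simp only [OrthonormalBasis.coe_toBasis, EuclideanSpace.basisFun_apply,
    ContinuousMultilinearMap.coe_coe, ContinuousMultilinearMap.sum_apply, tens_apply]
  rw [Finset.sum_eq_single w]
  · simp
  · intro w' _ hne
    obtain ⟨s, hs⟩ := Function.ne_iff.1 hne
    rw [Finset.prod_eq_zero (Finset.mem_univ s), zero_smul]
    simp [hs]
  · simp

section
variable {V E : Type*} [NormedAddCommGroup V] [InnerProductSpace ℝ V] [FiniteDimensional ℝ V]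
    [NormedAddCommGroup E] [InnerProductSpace ℝ E] [FiniteDimensional ℝ E] {n k : ℕ}

theorem tens_sum (w : Fin k → Fin n) {κ : Type} [Fintype κ] (c : κ → V) (a : κ → ℝ) :
    tens w (∑ l, a l • c l) = ∑ l, a l • tens w (c l) := by
  ext y
  simp only [tens_apply, ContinuousMultilinearMap.sum_apply, ContinuousMultilinearMap.smul_apply,
    Finset.smul_sum]
  exact Finset.sum_congr rfl fun l _ => smul_comm _ _ _

/-- matrix of the symbol -/
def symMat (A : DiffOperator (EuclideanSpace ℝ (Fin n)) k V E) :
    Matrix (Fin (Module.finrank ℝ E)) (Fin (Module.finrank ℝ V)) (MvPolynomial (Fin n) ℝ) :=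
  fun i l => ∑ w : Fin k → Fin n,
    MvPolynomial.C ⟪stdOrthonormalBasis ℝ E i, A (tens w (stdOrthonormalBasis ℝ V l))⟫ *
      ∏ s, MvPolynomial.X (w s)

theorem symMat_homog (A : DiffOperator (EuclideanSpace ℝ (Fin n)) k V E) (i l) :
    (symMat A i l).IsHomogeneous k := by
  refine MvPolynomial.IsHomogeneous.sum _ _ _ fun w _ => ?_
  have h1 : (∏ s, MvPolynomial.X (R := ℝ) (w s)).IsHomogeneous (∑ _s : Fin k, 1) :=
    MvPolynomial.IsHomogeneous.prod _ _ _ fun s _ => MvPolynomial.isHomogeneous_X _ _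
  have := (MvPolynomial.isHomogeneous_C (Fin n)
    ⟪stdOrthonormalBasis ℝ E i, A (tens w (stdOrthonormalBasis ℝ V l))⟫).mul h1
  simpa using this

theorem symbol_eq_s6 (A : DiffOperator (EuclideanSpace ℝ (Fin n)) k V E)
    (ξ : EuclideanSpace ℝ (Fin n)) (v : V) :
    A.symbol ξ v = ∑ w : Fin k → Fin n, (∏ s, ξ (w s)) • A (tens w v) := by
  have h : A.symbol ξ v = A ((ContinuousMultilinearMap.piFieldEquiv ℝ (Fin k)
      V v).compContinuousLinearMap (fun _ => innerSL ℝ ξ)) := rfl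
  rw [h, tens_expand ((ContinuousMultilinearMap.piFieldEquiv ℝ (Fin k)
      V v).compContinuousLinearMap (fun _ => innerSL ℝ ξ)), map_sum]
  refine Finset.sum_congr rfl fun w _ => ?_
  rw [← map_smul]
  congr 1
  ext y
  simp [tens_apply, ContinuousMultilinearMap.piFieldEquiv, eb,
    EuclideanSpace.inner_single_right, smul_smul, mul_comm]

theorem symMat_eval (A : DiffOperator (EuclideanSpace ℝ (Fin n)) k V E)
    (ξ : EuclideanSpace ℝ (Fin n)) (i l) :
    MvPolynomial.eval ξ (symMat A i l) =
      ⟪stdOrthonormalBasis ℝ E i, A.symbol ξ (stdOrthonormalBasis ℝ V l)⟫ := by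
  rw [symbol_eq_s6, inner_sum, symMat, map_sum]
  refine Finset.sum_congr rfl fun w _ => ?_
  rw [inner_smul_right, map_mul, map_prod]
  simp [mul_comm]

theorem symMat_mulVec (A : DiffOperator (EuclideanSpace ℝ (Fin n)) k V E)
    (ξ : EuclideanSpace ℝ (Fin n)) (v : Fin (Module.finrank ℝ V) → ℝ) (i) :
    ((symMat A).map (MvPolynomial.eval ξ)).mulVec v i =
      ⟪stdOrthonormalBasis ℝ E i, A.symbol ξ (∑ l, v l • stdOrthonormalBasis ℝ V l)⟫ := by
  rw [map_sum, inner_sum]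
  change ∑ l, MvPolynomial.eval ξ (symMat A i l) * v l = _
  refine Finset.sum_congr rfl fun l _ => ?_
  rw [symMat_eval, map_smul, inner_smul_right, mul_comm]

/-- scalar component of a test function -/
def comp {W : Type*} [NormedAddCommGroup W] [InnerProductSpace ℝ W] (b : W)
    (u : EuclideanSpace ℝ (Fin n) → W) (hu : IsTestFun u) : TF n :=
  ⟨fun x => ⟪b, u x⟫, contDiff_const.inner ℝ hu.1,
    hu.2.comp_left (g := fun y => ⟪b, y⟫) (inner_zero_right _)⟩

theorem iter_eq (f : TF n) : ∀ (k : ℕ) (w : Fin k → Fin n) (x),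
    iteratedFDeriv ℝ k f.1 x (fun s => eb (w s)) =
      (PD n (∏ s, MvPolynomial.X (w s)) f).1 x := by
  intro k
  induction k with
  | zero => intro w x; simp
  | succ k ih =>
    intro w x
    rw [iteratedFDeriv_succ_apply_left, Fin.prod_univ_succ, PD_mul, PD_X, pd_apply]
    have h : (PD n (∏ s : Fin k, MvPolynomial.X (w s.succ)) f).1 =
        fun x => iteratedFDeriv ℝ k f.1 x (fun s => eb (w s.succ)) :=
      funext fun x => (ih (fun s => w s.succ) x).symm
    rw [h]
    have hd : DifferentiableAt ℝ (iteratedFDeriv ℝ k f.1) x :=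
      ((TF.smooth f).differentiable_iteratedFDeriv (WithTop.coe_lt_coe.2 (WithTop.coe_lt_top k))) x
    have h2 := (hd.hasFDerivAt.continuousMultilinear_apply_const (fun s => eb (w s.succ))).fderiv
    rw [h2]
    rfl

theorem app_eq (A : DiffOperator (EuclideanSpace ℝ (Fin n)) k V E)
    (u : EuclideanSpace ℝ (Fin n) → V) (hu : IsTestFun u) (i) (x) :
    ⟪stdOrthonormalBasis ℝ E i, A.app u x⟫ =
      (∑ l, PD n (symMat A i l) (comp (stdOrthonormalBasis ℝ V l) u hu)).1 x := by
  have h1 : ∀ (l) (w : Fin k → Fin n), ⟪stdOrthonormalBasis ℝ V l,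
      iteratedFDeriv ℝ k u x (fun s => eb (w s))⟫ =
      (PD n (∏ s, MvPolynomial.X (w s)) (comp (stdOrthonormalBasis ℝ V l) u hu)).1 x := by
    intro l w
    rw [← iter_eq]
    have h2 := (innerSL ℝ (stdOrthonormalBasis ℝ V l)).iteratedFDeriv_comp_left
      (f := u) (x := x) (n := ((⊤ : ℕ∞) : WithTop ℕ∞)) (i := k) hu.1.contDiffAt
      (WithTop.coe_le_coe.2 le_top)
    have h3 : (innerSL ℝ (stdOrthonormalBasis ℝ V l)) ∘ u =
      (comp (stdOrthonormalBasis ℝ V l) u hu).1 := rfl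
    rw [← h3, h2]
    rfl
  rw [DiffOperator.app, tens_expand (iteratedFDeriv ℝ k u x), map_sum, inner_sum]
  have h4 : ∀ w : Fin k → Fin n,
      ⟪stdOrthonormalBasis ℝ E i, A (tens w (iteratedFDeriv ℝ k u x fun s => eb (w s)))⟫ =
      ∑ l, ⟪stdOrthonormalBasis ℝ E i, A (tens w (stdOrthonormalBasis ℝ V l))⟫ *
        (PD n (∏ s, MvPolynomial.X (w s)) (comp (stdOrthonormalBasis ℝ V l) u hu)).1 x := by
    intro w
    conv_lhs => rw [← (stdOrthonormalBasis ℝ V).sum_repr'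
      (iteratedFDeriv ℝ k u x fun s => eb (w s)), tens_sum, map_sum, inner_sum]
    refine Finset.sum_congr rfl fun l _ => ?_
    rw [h1, map_smul, inner_smul_right, mul_comm]
  simp only [h4]
  rw [Finset.sum_comm]
  simp only [symMat, ← MvPolynomial.smul_eq_C_mul, map_sum, map_smul, LinearMap.sum_apply,
    LinearMap.smul_apply]
  simp [Finset.sum_apply]
end

section
variable {V E : Type*} [NormedAddCommGroup V] [InnerProductSpace ℝ V] [FiniteDimensional ℝ V]
    [NormedAddCommGroup E] [InnerProductSpace ℝ E] [FiniteDimensional ℝ E] {n k : ℕ}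

/-- components of `A(D)u` -/
def appc (A : DiffOperator (EuclideanSpace ℝ (Fin n)) k V E)
    (u : EuclideanSpace ℝ (Fin n) → V) (hu : IsTestFun u) (i : Fin (Module.finrank ℝ E)) : TF n :=
  ∑ l, PD n (symMat A i l) (comp (stdOrthonormalBasis ℝ V l) u hu)

theorem onb_ext {ι : Type} [Fintype ι] (b : OrthonormalBasis ι ℝ E) {x y : E}
    (h : ∀ i, ⟪b i, x⟫ = ⟪b i, y⟫) : x = y := by
  rw [← b.sum_repr' x, ← b.sum_repr' y]
  exact Finset.sum_congr rfl fun i _ => by rw [h i]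

theorem compat_app (A : DiffOperator (EuclideanSpace ℝ (Fin n)) k V E)
    (u : EuclideanSpace ℝ (Fin n) → V) (hu : IsTestFun u) (j) :
    ∑ i, PD n (compatMat (symMat A) j i) (appc A u hu i) = 0 := by
  simp only [appc, map_sum, ← PD_mul]
  rw [Finset.sum_comm]
  refine Finset.sum_eq_zero fun l _ => ?_
  rw [← LinearMap.sum_apply, ← map_sum]
  have := congrFun (congrFun (compatMat_mul (symMat A)) j) l
  rw [Matrix.mul_apply] at this
  rw [this]
  simp

theorem compat_integral (A : DiffOperator (EuclideanSpace ℝ (Fin n)) k V E)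
    (u : EuclideanSpace ℝ (Fin n) → V) (hu : IsTestFun u) (j) (ψ : TF n) :
    ∑ i, ∫ x, (PD n (compatMat (symMat A) j i) ψ).1 x * (appc A u hu i).1 x = 0 := by
  have h : ∀ i, ∫ x, (PD n (compatMat (symMat A) j i) ψ).1 x * (appc A u hu i).1 x = _ :=
    fun i => hom_parts _ (compatMat_homog _ (symMat_homog A) j i) ψ (appc A u hu i)
  simp only [h]
  rw [← Finset.mul_sum, ← integral_finsetSum _ fun i _ => TF.integrable_mul _ _]
  have h2 : ∀ x, ∑ i, ψ.1 x * (PD n (compatMat (symMat A) j i) (appc A u hu i)).1 x = 0 := by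
    intro x
    rw [← Finset.mul_sum]
    have := congrFun (congrArg Subtype.val (compat_app A u hu j)) x
    have h3 : ∑ i, (PD n (compatMat (symMat A) j i) (appc A u hu i)).1 x = 0 := by
      simpa [Finset.sum_apply] using this
    rw [h3, mul_zero]
  simp [h2]

theorem app_cont (A : DiffOperator (EuclideanSpace ℝ (Fin n)) k V E)
    (u : EuclideanSpace ℝ (Fin n) → V) (hu : IsTestFun u) : Continuous (A.app u) :=
  A.continuous.comp (hu.1.continuous_iteratedFDeriv (WithTop.coe_le_coe.2 le_top))

theorem rhs_integrable (A : DiffOperator (EuclideanSpace ℝ (Fin n)) k V E)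
    (u : EuclideanSpace ℝ (Fin n) → V) (hu : IsTestFun u)
    {W : Type*} [NormedAddCommGroup W] [InnerProductSpace ℝ W]
    (φ : EuclideanSpace ℝ (Fin n) → W) (hφ : IsTestFun φ) (j : ℕ) :
    Integrable (fun x => ‖A.app u x‖ * ‖x‖ ^ j * ‖iteratedFDeriv ℝ j φ x‖) := by
  have h1 := (app_cont A u hu).norm
  have h2 : Continuous (iteratedFDeriv ℝ j φ) :=
    hφ.1.continuous_iteratedFDeriv (WithTop.coe_le_coe.2 le_top)
  refine Continuous.integrable_of_hasCompactSupport
    ((h1.mul (continuous_norm.pow j)).mul h2.norm) ?_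
  exact (hφ.2.iteratedFDeriv j).norm.mul_left

/-- the estimate for a fixed vector -/
def Good (A : DiffOperator (EuclideanSpace ℝ (Fin n)) k V E) (m : ℕ) (r : E) : Prop :=
  ∃ C : ℝ, 0 ≤ C ∧ ∀ (u : EuclideanSpace ℝ (Fin n) → V) (_ : IsTestFun u) (ψ : TF n),
    |∫ x, ψ.1 x * ⟪r, A.app u x⟫| ≤ C * ∑ j ∈ Finset.range m,
      ∫ x, ‖A.app u x‖ * ‖x‖ ^ (j + 1) * ‖iteratedFDeriv ℝ (j + 1) ψ.1 x‖

theorem lhs_integrable (A : DiffOperator (EuclideanSpace ℝ (Fin n)) k V E)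
    (u : EuclideanSpace ℝ (Fin n) → V) (hu : IsTestFun u) (r : E) (ψ : TF n) :
    Integrable (fun x => ψ.1 x * ⟪r, A.app u x⟫) :=
  Continuous.integrable_of_hasCompactSupport
    ((TF.smooth ψ).continuous.mul (continuous_const.inner (app_cont A u hu))) (TF.cs ψ).mul_right

/-- good vectors form a subspace -/
def goodSub (A : DiffOperator (EuclideanSpace ℝ (Fin n)) k V E) (m : ℕ) : Submodule ℝ E where
  carrier := {r | Good A m r}
  zero_mem' := ⟨0, le_rfl, fun u hu ψ => by simp⟩
  add_mem' := by
    rintro a b ⟨C1, h1, H1⟩ ⟨C2, h2, H2⟩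
    refine ⟨C1 + C2, add_nonneg h1 h2, fun u hu ψ => ?_⟩
    simp only [inner_add_left, mul_add]
    rw [integral_add (lhs_integrable A u hu a ψ) (lhs_integrable A u hu b ψ), add_mul]
    exact (abs_add_le _ _).trans (add_le_add (H1 u hu ψ) (H2 u hu ψ))
  smul_mem' := by
    rintro c a ⟨C1, h1, H1⟩
    refine ⟨|c| * C1, by positivity, fun u hu ψ => ?_⟩
    simp only [inner_smul_left, mul_left_comm _ (starRingEnd ℝ c)]
    rw [integral_const_mul, abs_mul, mul_assoc]
    exact mul_le_mul_of_nonneg_left (H1 u hu ψ) (abs_nonneg c)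

theorem good_row (A : DiffOperator (EuclideanSpace ℝ (Fin n)) k V E)
    (ξ : EuclideanSpace ℝ (Fin n)) (j : Fin (Module.finrank ℝ E)) :
    Good A (Fintype.card (Fin (Module.finrank ℝ V)) * (k + k))
      (∑ i, MvPolynomial.eval ξ (compatMat (symMat A) j i) • stdOrthonormalBasis ℝ E i) := by
  set m := Fintype.card (Fin (Module.finrank ℝ V)) * (k + k) with hm
  have hh := fun i => hom_main ξ _ (compatMat_homog _ (symMat_homog A) j i)
  choose C hC0 hC using hh
  have hf : (0 : ℝ) < m.factorial := by exact_mod_cast Nat.factorial_pos m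
  refine ⟨(m.factorial : ℝ)⁻¹ * ∑ i, C i,
    mul_nonneg (by positivity) (Finset.sum_nonneg fun i _ => hC0 i), fun u hu ψ => ?_⟩
  have happ : ∀ i x, ⟪stdOrthonormalBasis ℝ E i, A.app u x⟫ = (appc A u hu i).1 x :=
    fun i x => app_eq A u hu i x
  set S := ∑ j ∈ Finset.range m,
      ∫ x, ‖A.app u x‖ * ‖x‖ ^ (j + 1) * ‖iteratedFDeriv ℝ (j + 1) ψ.1 x‖ with hS
  have hint : ∫ x, ψ.1 x * ⟪∑ i, MvPolynomial.eval ξ (compatMat (symMat A) j i) •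
      stdOrthonormalBasis ℝ E i, A.app u x⟫ =
      ∑ i, MvPolynomial.eval ξ (compatMat (symMat A) j i) *
        ∫ x, ψ.1 x * (appc A u hu i).1 x := by
    simp only [sum_inner, inner_smul_left, happ, Finset.mul_sum, conj_trivial,
      mul_left_comm (ψ.1 _)]
    rw [integral_finsetSum _ fun i _ => (TF.integrable_mul _ _).const_mul _]
    simp only [integral_const_mul]
  have hI : ∀ i, |(∫ x, (PD n (compatMat (symMat A) j i) (mulT ξ m ψ)).1 x * (appc A u hu i).1 x) -
      m.factorial * MvPolynomial.eval ξ (compatMat (symMat A) j i) *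
        ∫ x, ψ.1 x * (appc A u hu i).1 x| ≤ C i * S := by
    intro i
    rw [← integral_const_mul, ← integral_sub (TF.integrable_mul _ _)
      ((TF.integrable_mul _ _).const_mul _), hS,
      ← integral_finsetSum _ fun j _ => rhs_integrable A u hu ψ.1 ψ.2 (j + 1),
      ← integral_const_mul, ← Real.norm_eq_abs]
    refine norm_integral_le_of_norm_le ((integrable_finsetSum _ fun j _ =>
      rhs_integrable A u hu ψ.1 ψ.2 (j + 1)).const_mul _) (Filter.Eventually.of_forall fun x => ?_)
    have e := hC i ψ x
    have e2 : |(appc A u hu i).1 x| ≤ ‖A.app u x‖ := by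
      rw [← happ]
      refine (abs_real_inner_le_norm _ _).trans ?_
      rw [(stdOrthonormalBasis ℝ E).norm_eq_one, one_mul]
    rw [Real.norm_eq_abs, ← mul_assoc, ← sub_mul, abs_mul]
    calc _ ≤ _ := mul_le_mul e e2 (abs_nonneg _) ((abs_nonneg _).trans e)
      _ = _ := by
        rw [mul_assoc, Finset.sum_mul]
        congr 1
        exact Finset.sum_congr rfl fun j _ => by ring
  have h0 := compat_integral A u hu j (mulT ξ m ψ)
  have h1 : |∑ i, ((∫ x, (PD n (compatMat (symMat A) j i) (mulT ξ m ψ)).1 x *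
      (appc A u hu i).1 x) - m.factorial * MvPolynomial.eval ξ (compatMat (symMat A) j i) *
        ∫ x, ψ.1 x * (appc A u hu i).1 x)| ≤ ∑ i, C i * S :=
    (Finset.abs_sum_le_sum_abs _ _).trans (Finset.sum_le_sum fun i _ => hI i)
  rw [Finset.sum_sub_distrib, h0, zero_sub, abs_neg, ← Finset.sum_mul] at h1
  simp only [mul_assoc (m.factorial : ℝ)] at h1
  rw [← Finset.mul_sum, abs_mul, abs_of_pos hf] at h1
  rw [hint, mul_assoc]
  rw [inv_mul_eq_div, le_div_iff₀ hf, mul_comm]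
  exact h1

theorem good_all (hn : 0 < n) (A : DiffOperator (EuclideanSpace ℝ (Fin n)) k V E)
    (hA : A.IsElliptic) (hAc : A.IsCanceling) (r : E) :
    Good A (Fintype.card (Fin (Module.finrank ℝ V)) * (k + k)) r := by
  set m := Fintype.card (Fin (Module.finrank ℝ V)) * (k + k) with hm
  have htop : goodSub A m = ⊤ := by
    rw [← Submodule.orthogonal_eq_bot_iff, Submodule.eq_bot_iff]
    intro e he
    have hmem : e ∈ (⋂ (ξ : EuclideanSpace ℝ (Fin n)) (_ : ξ ≠ 0), Set.range (A.symbol ξ)) := by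
      refine Set.mem_iInter₂.2 fun ξ hξ => ?_
      have hL : ∀ j, ∑ i, MvPolynomial.eval ξ (compatMat (symMat A) j i) *
          ⟪stdOrthonormalBasis ℝ E i, e⟫ = 0 := by
        intro j
        have := (Submodule.mem_orthogonal _ _).1 he _ (good_row A ξ j : _ ∈ goodSub A m)
        simpa [sum_inner, inner_smul_left] using this
      obtain ⟨v, hv⟩ := compatMat_range (symMat A) ξ (by
        intro v hv
        have h1 : A.symbol ξ (∑ l, v l • stdOrthonormalBasis ℝ V l) = 0 := by
          refine onb_ext (stdOrthonormalBasis ℝ E) ?_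
          intro i
          have := congrFun hv i
          rw [symMat_mulVec] at this
          simpa using this
        have h2 : ∑ l, v l • stdOrthonormalBasis ℝ V l = 0 :=
          hA ξ hξ (h1.trans (map_zero _).symm)
        have h3 := Fintype.linearIndependent_iff.1
          (stdOrthonormalBasis ℝ V).orthonormal.linearIndependent v h2
        exact funext h3) (fun i => ⟪stdOrthonormalBasis ℝ E i, e⟫) hL
      refine ⟨∑ l, v l • stdOrthonormalBasis ℝ V l, ?_⟩
      refine onb_ext (stdOrthonormalBasis ℝ E) ?_
      intro i
      have := congrFun hv i
      rw [symMat_mulVec] at this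
      simpa using this
    rw [hAc] at hmem
    exact hmem
  have : r ∈ goodSub A m := by rw [htop]; trivial
  exact this

end

/-- Lemma: duality estimate for elliptic canceling operators.
If `A(D)` is elliptic and canceling then there are `C > 0` and `m ∈ ℕ_*` such that
`|∫ φ · A(D)u| ≤ C ∑_{j=1}^m ∫ |A(D)u(x)| |x|^j |D^j φ(x)| dx`
for all test functions `u : ℝⁿ → V` and `φ : ℝⁿ → E`. -/
theorem statement6
    {V E : Type*} [NormedAddCommGroup V] [InnerProductSpace ℝ V] [FiniteDimensional ℝ V]
    [NormedAddCommGroup E] [InnerProductSpace ℝ E] [FiniteDimensional ℝ E]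
    {n k : ℕ} (hn : 0 < n) (hk : 0 < k)
    (A : DiffOperator (EuclideanSpace ℝ (Fin n)) k V E)
    (hA : A.IsElliptic) (hAc : A.IsCanceling) :
    ∃ C : ℝ, 0 < C ∧ ∃ m : ℕ, 0 < m ∧
      ∀ u : EuclideanSpace ℝ (Fin n) → V, IsTestFun u →
      ∀ φ : EuclideanSpace ℝ (Fin n) → E, IsTestFun φ →
        abs (∫ x, ⟪φ x, A.app u x⟫) ≤
          C * ∑ j ∈ Finset.Icc 1 m,
            ∫ x, ‖A.app u x‖ * ‖x‖ ^ j * ‖iteratedFDeriv ℝ j φ x‖ := by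
  set m := Fintype.card (Fin (Module.finrank ℝ V)) * (k + k) with hm
  have hg := fun i => good_all hn A hA hAc (stdOrthonormalBasis ℝ E i)
  choose C hC0 hC using hg
  have hCs : 0 ≤ ∑ i, C i := Finset.sum_nonneg fun i _ => hC0 i
  refine ⟨∑ i, C i + 1, by positivity, m + 1, Nat.succ_pos m, fun u hu φ hφ => ?_⟩
  set T : ℕ → ℝ := fun j => ∫ x, ‖A.app u x‖ * ‖x‖ ^ j * ‖iteratedFDeriv ℝ j φ x‖ with hT
  have hT0 : ∀ j, 0 ≤ T j := fun j => integral_nonneg fun x => by positivity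
  have hsum : ∑ j ∈ Finset.range m, T (j + 1) ≤ ∑ j ∈ Finset.Icc 1 (m + 1), T j := by
    have h1 : Finset.Icc 1 (m + 1) = Finset.Ico 1 (m + 2) := by ext; simp; omega
    rw [h1, Finset.sum_Ico_eq_sum_range, show m + 2 - 1 = m + 1 by omega, Finset.sum_range_succ]
    simp only [add_comm 1]
    linarith [hT0 (m + 1)]
  have hsum0 : 0 ≤ ∑ j ∈ Finset.Icc 1 (m + 1), T j := Finset.sum_nonneg fun j _ => hT0 j
  have hexp : ∫ x, ⟪φ x, A.app u x⟫ = ∑ i, ∫ x, (comp (stdOrthonormalBasis ℝ E i) φ hφ).1 x *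
      ⟪stdOrthonormalBasis ℝ E i, A.app u x⟫ := by
    rw [← integral_finsetSum _ fun i _ => lhs_integrable A u hu _ _]
    refine integral_congr_ae (Filter.Eventually.of_forall fun x => ?_)
    change ⟪φ x, A.app u x⟫ = ∑ i, ⟪stdOrthonormalBasis ℝ E i, φ x⟫ *
      ⟪stdOrthonormalBasis ℝ E i, A.app u x⟫
    rw [← (stdOrthonormalBasis ℝ E).sum_inner_mul_inner]
    exact Finset.sum_congr rfl fun i _ => by rw [real_inner_comm]
  have hb : ∀ i, |∫ x, (comp (stdOrthonormalBasis ℝ E i) φ hφ).1 x *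
      ⟪stdOrthonormalBasis ℝ E i, A.app u x⟫| ≤ C i * ∑ j ∈ Finset.Icc 1 (m + 1), T j := by
    intro i
    refine (hC i u hu _).trans (mul_le_mul_of_nonneg_left (le_trans ?_ hsum) (hC0 i))
    refine Finset.sum_le_sum fun j _ => ?_
    refine integral_mono (rhs_integrable A u hu _ (comp (stdOrthonormalBasis ℝ E i) φ hφ).2 (j + 1))
      (rhs_integrable A u hu φ hφ (j + 1)) fun x => ?_
    refine mul_le_mul_of_nonneg_left ?_ (by positivity)
    have h2 := (innerSL ℝ (stdOrthonormalBasis ℝ E i)).norm_iteratedFDeriv_comp_left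
      (f := φ) (x := x) (N := ((⊤ : ℕ∞) : WithTop ℕ∞)) (n := j + 1) hφ.1.contDiffAt
      (WithTop.coe_le_coe.2 le_top)
    rw [innerSL_apply_norm, (stdOrthonormalBasis ℝ E).norm_eq_one, one_mul] at h2
    exact h2
  rw [hexp]
  calc _ ≤ ∑ i, C i * ∑ j ∈ Finset.Icc 1 (m + 1), T j :=
        (Finset.abs_sum_le_sum_abs _ _).trans (Finset.sum_le_sum fun i _ => hb i)
    _ ≤ (∑ i, C i + 1) * ∑ j ∈ Finset.Icc 1 (m + 1), T j := by
        rw [← Finset.sum_mul, add_mul, one_mul]; linarith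
end
end
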